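/- arXiv:1603.07883 — 2 statements merged into one kernel-verified Lean document; each statement's English description precedes it below -/
import Mathlib

section
/- Let 0 ≤ p1 = p1(n), p2 = p2(n) ≤ 1 and let G1 ∼ G(n,p1) and G2 ∼ G(n,p2) independently. Then there exists a constant c > 0 such that: (1) if p1·p2 ≤ 1/(c·n·log n), then with high probability (G1,G2) does not percolate; (2) if p1·p2 ≥ c/(n·log n) and min{p1,p2} ≥ c·log n/n, then with high probability (G1,G2) percolates. -/
open Finset Filter

/-- Two clusters `C`, `C'` of `j`-sets can be merged: they are joined by an edge of `E1` (red)
and an edge of `E2` (blue). -/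
def Mergeable {V : Type*} [DecidableEq V] (E1 E2 C C' : Finset (Finset V)) : Prop :=
  (∃ J1 ∈ C, ∃ J1' ∈ C', ∃ e1 ∈ E1, J1 ∪ J1' ⊆ e1) ∧
  (∃ J2 ∈ C, ∃ J2' ∈ C', ∃ e2 ∈ E2, J2 ∪ J2' ⊆ e2)

/-- One elementary merging step of the jigsaw percolation process on the double hypergraph
`(V, E1, E2)`: two distinct mergeable clusters of the current partition `P` are replaced by
their union.  Iterating such pairwise merges as long as possible yields exactly the final
partition of the (deterministic) jigsaw percolation process. -/
def MergeStep {V : Type*} [DecidableEq V] (E1 E2 : Finset (Finset V))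
    (P P' : Finset (Finset (Finset V))) : Prop :=
  ∃ C ∈ P, ∃ C' ∈ P, C ≠ C' ∧ Mergeable E1 E2 C C' ∧
    P' = insert (C ∪ C') ((P.erase C).erase C')

/-- The family `J0` of `j`-sets percolates on the double hypergraph `(V, E1, E2)`:
starting from the partition of `J0` into singletons, a sequence of merges reaches the
partition with a single class. -/
def PercolatesOn {V : Type*} [DecidableEq V] (J0 E1 E2 : Finset (Finset V)) : Prop :=
  Relation.ReflTransGen (MergeStep E1 E2)
    (J0.image fun J => ({J} : Finset (Finset V))) {J0}

/-- The double `k`-graph `(V, E1, E2)` `j`-percolates: the family of all `j`-element subsets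
of `V` percolates on `(V, E1, E2)`. -/
def JPercolates {V : Type*} [DecidableEq V] [Fintype V] (j : ℕ)
    (E1 E2 : Finset (Finset V)) : Prop :=
  PercolatesOn ((Finset.univ : Finset V).powersetCard j) E1 E2
open scoped Classical in
/-- The probability that a pair of independent binomial random subsets of the ground set `K`
(where each element of `K` is included in the first subset with probability `p1` and in the
second with probability `p2`, independently) satisfies the event `A`. -/
noncomputable def probDouble {α : Type*} [DecidableEq α] (K : Finset α) (p1 p2 : ℝ)
    (A : Finset α → Finset α → Prop) : ℝ :=
  ∑ E1 ∈ K.powerset, ∑ E2 ∈ K.powerset,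
    if A E1 E2 then
      p1 ^ E1.card * (1 - p1) ^ (K.card - E1.card) *
        p2 ^ E2.card * (1 - p2) ^ (K.card - E2.card)
    else 0

/-- The probability that the random double `k`-graph `H ~ H_k(n, p1, p2)` on vertex set
`Fin n` (each `k`-set is a red edge with probability `p1` and a blue edge with probability
`p2`, independently over colours and `k`-sets) satisfies the event `A`. -/
noncomputable def probHk (n k : ℕ) (p1 p2 : ℝ)
    (A : Finset (Finset (Fin n)) → Finset (Finset (Fin n)) → Prop) : ℝ :=
  probDouble ((Finset.univ : Finset (Fin n)).powersetCard k) p1 p2 A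

namespace Jig
open MeasureTheory ProbabilityTheory

abbrev Om (n : ℕ) := Bool × Finset (Fin n) → Bool

noncomputable def bern (p : ℝ) : Measure Bool :=
  (volume : Measure unitInterval).map (fun u : unitInterval => decide ((u : ℝ) ≤ p))

lemma meas_thr (p : ℝ) : Measurable (fun u : unitInterval => decide ((u : ℝ) ≤ p)) := by
  apply measurable_to_bool
  have : (fun u : unitInterval => decide ((u : ℝ) ≤ p)) ⁻¹' {true} = {u : unitInterval | (u : ℝ) ≤ p} := by
    ext; simp
  rw [this]
  exact measurableSet_le (by fun_prop) (by fun_prop)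

instance (p : ℝ) : IsProbabilityMeasure (bern p) :=
  Measure.isProbabilityMeasure_map (meas_thr p).aemeasurable

lemma bern_true {p : ℝ} (h0 : 0 ≤ p) (h1 : p ≤ 1) : (bern p).real {true} = p := by
  unfold bern
  rw [map_measureReal_apply (meas_thr p) (by simp)]
  have : (fun u : unitInterval => decide ((u : ℝ) ≤ p)) ⁻¹' {true}
      = Set.Iic (⟨p, h0, h1⟩ : unitInterval) := by
    ext u; simp [← Subtype.coe_le_coe]
  rw [this, Measure.real, unitInterval.volume_Iic]
  simp [h0]

lemma bern_false {p : ℝ} (h0 : 0 ≤ p) (h1 : p ≤ 1) : (bern p).real {false} = 1 - p := by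
  have h : ({false} : Set Bool) = {true}ᶜ := by ext b; cases b <;> simp
  rw [h, probReal_compl_eq_one_sub (by simp), bern_true h0 h1]

noncomputable def mu (n : ℕ) (P : Bool → ℝ) : Measure (Om n) :=
  Measure.pi (fun i => bern (P i.1))

instance (n : ℕ) (P : Bool → ℝ) : IsProbabilityMeasure (mu n P) := by
  unfold mu; infer_instance

lemma msr {n : ℕ} (A : Set (Om n)) : MeasurableSet A := (Set.toFinite A).measurableSet

/-- probability of an event -/
noncomputable def pr (n : ℕ) (P : Bool → ℝ) (A : Om n → Prop) : ℝ := (mu n P).real {ω | A ω}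

variable {n : ℕ} {P : Bool → ℝ}

lemma pr_nonneg (A : Om n → Prop) : 0 ≤ pr n P A := measureReal_nonneg
lemma pr_le_one (A : Om n → Prop) : pr n P A ≤ 1 := measureReal_le_one
lemma pr_mono {A B : Om n → Prop} (h : ∀ ω, A ω → B ω) : pr n P A ≤ pr n P B :=
  measureReal_mono h
lemma pr_congr {A B : Om n → Prop} (h : ∀ ω, A ω ↔ B ω) : pr n P A = pr n P B :=
  le_antisymm (pr_mono fun ω => (h ω).1) (pr_mono fun ω => (h ω).2)
lemma pr_not (A : Om n → Prop) : pr n P (fun ω => ¬ A ω) = 1 - pr n P A :=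
  probReal_compl_eq_one_sub (msr _)
lemma pr_or (A B : Om n → Prop) : pr n P (fun ω => A ω ∨ B ω) ≤ pr n P A + pr n P B :=
  measureReal_union_le _ _
lemma pr_ex {β : Type*} (s : Finset β) (A : β → Om n → Prop) :
    pr n P (fun ω => ∃ b ∈ s, A b ω) ≤ ∑ b ∈ s, pr n P (A b) := by
  have := measureReal_biUnion_finset_le (μ := mu n P) s (fun b => {ω | A b ω})
  refine le_trans (le_of_eq ?_) this
  unfold pr; congr 1; ext ω; simp

/-- `A` only depends on the coordinates in `S`. -/
def Dep (S : Finset (Bool × Finset (Fin n))) (A : Om n → Prop) : Prop :=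
  ∀ ω ω' : Om n, (∀ i ∈ S, ω i = ω' i) → (A ω → A ω')

lemma Dep.not {S : Finset (Bool × Finset (Fin n))} {A : Om n → Prop} (h : Dep S A) :
    Dep S (fun ω => ¬ A ω) :=
  fun ω ω' hh ha hb => ha (h ω' ω (fun i hi => (hh i hi).symm) hb)

lemma Dep.mono {S T : Finset (Bool × Finset (Fin n))} {A : Om n → Prop} (h : Dep S A)
    (hST : S ⊆ T) : Dep T A := fun ω ω' hh => h ω ω' fun i hi => hh i (hST hi)

lemma pr_and {S T : Finset (Bool × Finset (Fin n))} {A B : Om n → Prop} (hA : Dep S A)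
    (hB : Dep T B) (hST : Disjoint S T) :
    pr n P (fun ω => A ω ∧ B ω) = pr n P A * pr n P B := by
  have h1 : iIndepFun (fun (i : Bool × Finset (Fin n)) (ω : Om n) => ω i) (mu n P) := by
    have := iIndepFun_pi (μ := fun i : Bool × Finset (Fin n) => bern (P i.1))
      (X := fun _ (b : Bool) => b) (fun i => measurable_id.aemeasurable)
    exact this
  have h2 := h1.indepFun_finset S T hST (fun i => measurable_pi_apply i)
  rw [indepFun_iff_measure_inter_preimage_eq_mul] at h2
  have h3 := h2 ((fun (a : Om n) (i : S) => a i) '' {ω | A ω})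
    ((fun (a : Om n) (i : T) => a i) '' {ω | B ω}) (Set.toFinite _).measurableSet
    (Set.toFinite _).measurableSet
  have eA : (fun (a : Om n) (i : S) => a i) ⁻¹' ((fun (a : Om n) (i : S) => a i) '' {ω | A ω})
      = {ω | A ω} := by
    apply Set.Subset.antisymm _ (Set.subset_preimage_image _ _)
    rintro ω ⟨ω', h, e⟩
    exact hA ω' ω (fun i hi => congrFun e ⟨i, hi⟩) h
  have eB : (fun (a : Om n) (i : T) => a i) ⁻¹' ((fun (a : Om n) (i : T) => a i) '' {ω | B ω})
      = {ω | B ω} := by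
    apply Set.Subset.antisymm _ (Set.subset_preimage_image _ _)
    rintro ω ⟨ω', h, e⟩
    exact hB ω' ω (fun i hi => congrFun e ⟨i, hi⟩) h
  rw [eA, eB] at h3
  unfold pr Measure.real
  rw [← ENNReal.toReal_mul, ← h3]
  rfl

lemma pr_cyl (hP : ∀ b, 0 ≤ P b ∧ P b ≤ 1) (S : Finset (Bool × Finset (Fin n)))
    (g : Bool × Finset (Fin n) → Bool) :
    pr n P (fun ω => ∀ i ∈ S, ω i = g i)
      = ∏ i ∈ S, (if g i then P i.1 else 1 - P i.1) := by
  have e : {ω : Om n | ∀ i ∈ S, ω i = g i}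
      = Set.pi Set.univ (fun i => if i ∈ S then {g i} else Set.univ) := by
    ext ω
    simp only [Set.mem_ofPred_eq, Set.mem_pi, Set.mem_univ, true_imp_iff]
    refine forall_congr' fun i => ?_
    by_cases h : i ∈ S <;> simp [h]
  unfold pr mu Measure.real
  rw [e, Measure.pi_pi, ENNReal.toReal_prod, ← Finset.prod_subset (Finset.subset_univ S)]
  · refine Finset.prod_congr rfl fun i hi => ?_
    simp only [hi, if_true]
    cases hg : g i
    · exact bern_false (hP _).1 (hP _).2
    · exact bern_true (hP _).1 (hP _).2
  · intro i _ hi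
    rw [if_neg hi, measure_univ]; rfl

lemma pr_mono_p {P Q : Bool → ℝ} (h : ∀ b, P b ≤ Q b) {A : Om n → Prop}
    (hA : ∀ ω ω' : Om n, (∀ i, ω i = true → ω' i = true) → A ω → A ω') :
    pr n P A ≤ pr n Q A := by
  have key : ∀ R : Bool → ℝ, mu n R = (Measure.pi (fun _ : Bool × Finset (Fin n) =>
      (volume : Measure unitInterval))).map (fun u i => decide ((u i : ℝ) ≤ R i.1)) := by
    intro R
    have : ∀ i : Bool × Finset (Fin n), SigmaFinite
      ((volume : Measure unitInterval).map (fun u : unitInterval => decide ((u : ℝ) ≤ R i.1))) := fun i => by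
        have : IsProbabilityMeasure (bern (R i.1)) := inferInstance
        unfold bern at this
        infer_instance
    rw [Measure.pi_map_pi (f := fun (i : Bool × Finset (Fin n)) (u : unitInterval) =>
      decide ((u : ℝ) ≤ R i.1)) (fun i => (meas_thr _).aemeasurable)]
    rfl
  have mm : ∀ R : Bool → ℝ, Measurable (fun (u : Bool × Finset (Fin n) → unitInterval)
      (i : Bool × Finset (Fin n)) => decide ((u i : ℝ) ≤ R i.1)) := fun R =>
    measurable_pi_lambda _ fun i => (meas_thr (R i.1)).comp (measurable_pi_apply i)
  unfold pr
  rw [key P, key Q, map_measureReal_apply (mm P) (msr _), map_measureReal_apply (mm Q) (msr _)]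
  refine measureReal_mono ?_ (measure_ne_top _ _)
  intro u hu
  refine hA _ _ ?_ hu
  intro i hi
  simp only [decide_eq_true_eq] at hi ⊢
  exact hi.trans (h _)

/-- The edge set of colour `b`. -/
def edges (b : Bool) (ω : Om n) : Finset (Finset (Fin n)) :=
  (Finset.univ.powersetCard 2).filter (fun e => ω (b, e) = true)

def Pp (p1 p2 : ℝ) : Bool → ℝ := fun b => if b then p1 else p2

lemma transfer (n : ℕ) {p1 p2 : ℝ} (h1 : 0 ≤ p1 ∧ p1 ≤ 1) (h2 : 0 ≤ p2 ∧ p2 ≤ 1)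
    (A : Finset (Finset (Fin n)) → Finset (Finset (Fin n)) → Prop) :
    probHk n 2 p1 p2 A = pr n (Pp p1 p2) (fun ω => A (edges true ω) (edges false ω)) := by
  classical
  set K := (Finset.univ : Finset (Fin n)).powersetCard 2 with hK
  have hP : ∀ b, 0 ≤ Pp p1 p2 b ∧ Pp p1 p2 b ≤ 1 := by
    intro b; cases b <;> simp [Pp, h1, h2]
  have atom : ∀ E1 ∈ K.powerset, ∀ E2 ∈ K.powerset,
      pr n (Pp p1 p2) (fun ω => edges true ω = E1 ∧ edges false ω = E2) =
      p1 ^ E1.card * (1 - p1) ^ (K.card - E1.card) *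
        p2 ^ E2.card * (1 - p2) ^ (K.card - E2.card) := by
    intro E1 hE1 E2 hE2
    rw [Finset.mem_powerset] at hE1 hE2
    have e := pr_cyl (n := n) hP (Finset.univ ×ˢ K)
      (fun i => decide (i.2 ∈ if i.1 then E1 else E2))
    have aux : ∀ (b : Bool) (ω : Om n) (E : Finset (Finset (Fin n))), E ⊆ K →
        (edges b ω = E ↔ ∀ x ∈ K, ω (b, x) = decide (x ∈ E)) := by
      intro b ω E hE
      constructor
      · rintro rfl x hx
        rw [Bool.eq_iff_iff]
        simp [edges, ← hK, hx]
      · intro h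
        ext x
        simp only [edges, ← hK, Finset.mem_filter]
        constructor
        · rintro ⟨hx, hw⟩
          rw [h x hx] at hw; simpa using hw
        · intro hx
          exact ⟨hE hx, by rw [h x (hE hx)]; simpa using hx⟩
    have aux2 : ∀ (p : ℝ) (E : Finset (Finset (Fin n))), E ⊆ K →
        ∏ x ∈ K, (if x ∈ E then p else 1 - p) = p ^ E.card * (1 - p) ^ (K.card - E.card) := by
      intro p E hE
      rw [Finset.prod_ite, Finset.prod_const, Finset.prod_const, Finset.filter_mem_eq_inter,
        Finset.inter_eq_right.2 hE, Finset.filter_notMem_eq_sdiff, Finset.card_sdiff_of_subset hE]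
    rw [Finset.prod_product, Fintype.prod_bool] at e
    simp only [decide_eq_true_eq, Pp, if_true, Bool.false_eq_true, if_false] at e
    rw [aux2 _ _ hE1, aux2 _ _ hE2, ← mul_assoc] at e
    rw [← e]
    apply pr_congr
    intro ω
    rw [aux _ _ _ hE1, aux _ _ _ hE2]
    simp [Finset.mem_product]
    tauto
  unfold probHk probDouble
  rw [← hK]
  rw [← Finset.sum_product']
  have key := sum_measureReal_preimage_singleton (μ := mu n (Pp p1 p2))
    ((K.powerset ×ˢ K.powerset).filter (fun E => A E.1 E.2))
    (f := fun ω : Om n => (edges true ω, edges false ω)) (fun _ _ => msr _)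
  have key2 : pr n (Pp p1 p2) (fun ω => A (edges true ω) (edges false ω))
    = (mu n (Pp p1 p2)).real ((fun ω : Om n => (edges true ω, edges false ω)) ⁻¹'
      ((K.powerset ×ˢ K.powerset).filter (fun E => A E.1 E.2))) := by
    unfold pr
    congr 1
    ext ω
    simp [edges, hK]
  rw [key2, ← key, Finset.sum_filter]
  refine Finset.sum_congr rfl fun E hE => ?_
  rw [Finset.mem_product] at hE
  split_ifs
  · rw [← atom _ hE.1 _ hE.2]
    unfold pr
    congr 1
    ext ω
    simp [Prod.ext_iff]
  · rfl

end Jig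

namespace Jig

variable {n : ℕ}

def joined (ω : Om n) (X : Finset (Fin n)) (w : Fin n) : Prop :=
  ∀ b, ∃ x ∈ X, ω (b, {x, w}) = true

def TreeOn (ω : Om n) (b : Bool) (S : Finset (Fin n)) : Prop :=
  ∀ r ∈ S, ∃ f : Fin n → Fin n, ∃ h : Fin n → ℕ,
    ∀ v ∈ S, v ≠ r → f v ∈ S ∧ ω (b, {v, f v}) = true ∧ h (f v) < h v

lemma tree_single (ω : Om n) (b : Bool) (v : Fin n) : TreeOn ω b {v} := by
  intro r hr
  refine ⟨id, fun _ => 0, fun w hw hne => ?_⟩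
  simp at hr hw
  exact absurd (hw.trans hr.symm) hne

lemma tree_union {ω : Om n} {b : Bool} {S T : Finset (Fin n)} (hS : TreeOn ω b S)
    (hT : TreeOn ω b T) (hd : Disjoint S T) {x y : Fin n} (hx : x ∈ S) (hy : y ∈ T)
    (he : ω (b, {x, y}) = true) : TreeOn ω b (S ∪ T) := by
  have main : ∀ (S T : Finset (Fin n)), TreeOn ω b S → TreeOn ω b T → Disjoint S T →
      ∀ x y, x ∈ S → y ∈ T → ω (b, {y, x}) = true → ∀ r ∈ S, ∃ f : Fin n → Fin n,
      ∃ h : Fin n → ℕ, ∀ v ∈ S ∪ T, v ≠ r →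
        f v ∈ S ∪ T ∧ ω (b, {v, f v}) = true ∧ h (f v) < h v := by
    intro S T hS hT hd x y hx hy he r hr
    obtain ⟨f, h, hf⟩ := hS r hr
    obtain ⟨g, k, hg⟩ := hT y hy
    have hnS : ∀ v ∈ T, v ∉ S := fun v hv hv' => Finset.disjoint_left.1 hd hv' hv
    refine ⟨fun v => if v ∈ S then f v else if v = y then x else g v,
      fun v => if v ∈ S then h v else h x + 1 + k v, fun v hv hne => ?_⟩
    by_cases hvS : v ∈ S
    · obtain ⟨h1, h2, h3⟩ := hf v hvS hne
      simp [hvS, h1, h2, h3]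
    · have hvT : v ∈ T := by
        rcases Finset.mem_union.1 hv with h | h
        · exact absurd h hvS
        · exact h
      by_cases hvy : v = y
      · subst hvy
        simp [hvS, hx, he]; omega
      · obtain ⟨h1, h2, h3⟩ := hg v hvT hvy
        simp [hvS, hvy, h1, h2, hnS _ h1, h3]
  intro r hr
  rcases Finset.mem_union.1 hr with h | h
  · exact main S T hS hT hd x y hx hy (by rw [Finset.pair_comm]; exact he) r h
  · rw [Finset.union_comm]
    exact main T S hT hS hd.symm y x hy hx he r h

def Spanned (ω : Om n) (S : Finset (Fin n)) : Prop := S.Nonempty ∧ ∀ b, TreeOn ω b S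

def toV (C : Finset (Finset (Fin n))) : Finset (Fin n) :=
  Finset.univ.filter (fun v => ({v} : Finset (Fin n)) ∈ C)

lemma mem_toV {C : Finset (Finset (Fin n))} {v : Fin n} : v ∈ toV C ↔ {v} ∈ C := by
  simp [toV]

lemma toV_union (C D : Finset (Finset (Fin n))) : toV (C ∪ D) = toV C ∪ toV D := by
  ext v; simp [mem_toV]

lemma exists_spanned {ω : Om n} (hp : JPercolates 1 (edges true ω) (edges false ω))
    {k : ℕ} (hk : 2 ≤ k) (hkn : k ≤ n) :
    ∃ S, k ≤ S.card ∧ S.card ≤ 2 * k ∧ Spanned ω S := by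
  by_contra hcon
  push Not at hcon
  have hsp : ∀ S : Finset (Fin n), Spanned ω S → S.card ≤ 2 * k → S.card < k := by
    intro S hS h2
    by_contra h
    exact hcon S (by omega) h2 hS
  have inv : ∀ Q, Relation.ReflTransGen (MergeStep (edges true ω) (edges false ω))
      (((Finset.univ : Finset (Fin n)).powersetCard 1).image
        fun J => ({J} : Finset (Finset (Fin n)))) Q →
      (∀ C ∈ Q, Spanned ω (toV C) ∧ (toV C).card < k ∧ ∀ J ∈ C, J.card = 1) ∧
      (∀ C ∈ Q, ∀ D ∈ Q, C ≠ D → Disjoint C D) := by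
    intro Q hQ
    induction hQ with
    | refl =>
      constructor
      · intro C hC
        simp only [Finset.mem_image, Finset.mem_powersetCard_univ] at hC
        obtain ⟨J, hJ, rfl⟩ := hC
        obtain ⟨v, rfl⟩ := Finset.card_eq_one.1 hJ
        have : toV ({{v}} : Finset (Finset (Fin n))) = {v} := by
          ext w; simp [mem_toV]
        rw [this]
        refine ⟨⟨by simp, fun b => tree_single ω b v⟩, by simp; omega, by simp⟩
      · intro C hC D hD hne
        simp only [Finset.mem_image] at hC hD
        obtain ⟨J, _, rfl⟩ := hC
        obtain ⟨J', _, rfl⟩ := hD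
        rw [Finset.disjoint_singleton]
        rintro rfl
        exact hne rfl
    | @tail Q0 Q1 _ hstep ih =>
      obtain ⟨ih1, ih2⟩ := ih
      obtain ⟨C, hC, D, hD, hne, ⟨hm1, hm2⟩, rfl⟩ := hstep
      have hdis := ih2 C hC D hD hne
      have hdV : Disjoint (toV C) (toV D) := by
        rw [Finset.disjoint_left]
        intro v h1 h2
        exact Finset.disjoint_left.1 hdis (mem_toV.1 h1) (mem_toV.1 h2)
      have edge : ∀ b, (∃ J1 ∈ C, ∃ J1' ∈ D, ∃ e1 ∈ edges b ω, J1 ∪ J1' ⊆ e1) →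
          TreeOn ω b (toV C ∪ toV D) := by
        rintro b ⟨J, hJ, J', hJ', e, he, hsub⟩
        obtain ⟨x, rfl⟩ := Finset.card_eq_one.1 ((ih1 C hC).2.2 J hJ)
        obtain ⟨y, rfl⟩ := Finset.card_eq_one.1 ((ih1 D hD).2.2 J' hJ')
        have hxy : x ≠ y := by
          rintro rfl
          exact Finset.disjoint_left.1 hdis hJ hJ'
        simp only [edges, Finset.mem_filter, Finset.mem_powersetCard_univ] at he
        have : ({x} ∪ {y} : Finset (Fin n)) = e := by
          apply Finset.eq_of_subset_of_card_le hsub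
          rw [he.1, Finset.card_union_of_disjoint (by simpa using hxy)]
          simp
        refine tree_union ((ih1 C hC).1.2 b) ((ih1 D hD).1.2 b) hdV (mem_toV.2 hJ)
          (mem_toV.2 hJ') ?_
        rw [show ({x, y} : Finset (Fin n)) = {x} ∪ {y} from rfl, this]
        exact he.2
      have hspan : Spanned ω (toV (C ∪ D)) := by
        rw [toV_union]
        refine ⟨(ih1 C hC).1.1.mono Finset.subset_union_left, fun b => ?_⟩
        cases b
        · exact edge false hm2
        · exact edge true hm1
      constructor
      · intro B hB
        rcases Finset.mem_insert.1 hB with rfl | hB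
        · refine ⟨hspan, hsp _ hspan ?_, ?_⟩
          · rw [toV_union]
            refine (Finset.card_union_le _ _).trans ?_
            have := (ih1 C hC).2.1
            have := (ih1 D hD).2.1
            omega
          · intro J hJ
            rcases Finset.mem_union.1 hJ with h | h
            · exact (ih1 C hC).2.2 J h
            · exact (ih1 D hD).2.2 J h
        · exact ih1 B (Finset.mem_of_mem_erase (Finset.mem_of_mem_erase hB))
      · have aux : ∀ B ∈ (Q0.erase C).erase D,
            Disjoint (C ∪ D) B := by
          intro B hB
          rw [Finset.mem_erase, Finset.mem_erase] at hB
          rw [Finset.disjoint_union_left]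
          exact ⟨ih2 C hC B hB.2.2 (Ne.symm hB.2.1), ih2 D hD B hB.2.2 (Ne.symm hB.1)⟩
        intro A hA B hB hAB
        rcases Finset.mem_insert.1 hA with rfl | hA' <;>
          rcases Finset.mem_insert.1 hB with rfl | hB'
        · exact absurd rfl hAB
        · exact aux B hB'
        · exact (aux A hA').symm
        · exact ih2 A (Finset.mem_of_mem_erase (Finset.mem_of_mem_erase hA')) B
            (Finset.mem_of_mem_erase (Finset.mem_of_mem_erase hB')) hAB
  have := ((inv _ hp).1 _ (Finset.mem_singleton_self _)).2.1
  have e : toV ((Finset.univ : Finset (Fin n)).powersetCard 1) = Finset.univ := by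
    ext v; simp [mem_toV]
  rw [e] at this
  simp at this
  omega

inductive Span (ω : Om n) : Finset (Fin n) → Prop
  | single (v : Fin n) : Span ω {v}
  | step (S : Finset (Fin n)) (w : Fin n) : Span ω S → w ∉ S → joined ω S w → Span ω (insert w S)

lemma Span.nonempty {ω : Om n} {S : Finset (Fin n)} (h : Span ω S) : S.Nonempty := by
  cases h <;> simp

lemma Span.spanned {ω : Om n} {S : Finset (Fin n)} (h : Span ω S) : Spanned ω S := by
  induction h with
  | single v => exact ⟨by simp, fun b => tree_single ω b v⟩
  | step S w hS hw hj ih =>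
    refine ⟨by simp, fun b => ?_⟩
    obtain ⟨x, hx, he⟩ := hj b
    rw [Finset.insert_eq, Finset.union_comm]
    exact tree_union (ih.2 b) (tree_single ω b w) (by simpa using hw) hx (by simp) he

def sg (v : Fin n) : Finset (Finset (Fin n)) := {{v}}

lemma sg_inj : Function.Injective (sg : Fin n → _) := by
  intro v w h; simpa [sg] using h

def St (S : Finset (Fin n)) : Finset (Finset (Finset (Fin n))) :=
  insert (S.image (fun v => ({v} : Finset (Fin n)))) (Sᶜ.image sg)

lemma Span.reach {ω : Om n} {S : Finset (Fin n)} (h : Span ω S) :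
    Relation.ReflTransGen (MergeStep (edges true ω) (edges false ω))
      (((Finset.univ : Finset (Fin n)).powersetCard 1).image
        fun J => ({J} : Finset (Finset (Fin n)))) (St S) := by
  induction h with
  | single v =>
    have : (((Finset.univ : Finset (Fin n)).powersetCard 1).image
        fun J => ({J} : Finset (Finset (Fin n)))) = St {v} := by
      ext C
      simp only [St, Finset.mem_image, Finset.mem_powersetCard_univ, Finset.mem_insert,
        Finset.image_singleton, Finset.mem_compl, Finset.mem_singleton, sg]
      constructor
      · rintro ⟨J, hJ, rfl⟩
        obtain ⟨w, rfl⟩ := Finset.card_eq_one.1 hJ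
        by_cases hwv : w = v
        · left; rw [hwv]
        · right; exact ⟨w, hwv, rfl⟩
      · rintro (rfl | ⟨w, _, rfl⟩)
        · exact ⟨{v}, by simp, rfl⟩
        · exact ⟨{w}, by simp, rfl⟩
    rw [this]
  | step S w hS hw hj ih =>
    refine ih.tail ?_
    have hnot : S.image (fun v => ({v} : Finset (Fin n))) ∉ Sᶜ.image sg := by
      intro hmem
      obtain ⟨v, hv, he⟩ := Finset.mem_image.1 hmem
      obtain ⟨u, hu⟩ := hS.nonempty
      have : ({u} : Finset (Fin n)) ∈ sg v := by
        rw [he]; exact Finset.mem_image_of_mem _ hu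
      simp [sg] at this
      subst this
      exact Finset.mem_compl.1 hv hu
    have hwm : sg w ∈ Sᶜ.image sg := Finset.mem_image_of_mem _ (Finset.mem_compl.2 hw)
    refine ⟨S.image (fun v => ({v} : Finset (Fin n))), Finset.mem_insert_self _ _, sg w,
      Finset.mem_insert_of_mem hwm, ?_, ?_, ?_⟩
    · intro h; rw [h] at hnot; exact hnot hwm
    · have aux : ∀ b, ∃ J1 ∈ S.image (fun v => ({v} : Finset (Fin n))), ∃ J1' ∈ sg w,
          ∃ e1 ∈ edges b ω, J1 ∪ J1' ⊆ e1 := by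
        intro b
        obtain ⟨x, hx, he⟩ := hj b
        refine ⟨{x}, Finset.mem_image_of_mem _ hx, {w}, by simp [sg], {x, w}, ?_, ?_⟩
        · simp only [edges, Finset.mem_filter, Finset.mem_powersetCard_univ]
          refine ⟨Finset.card_pair ?_, he⟩
          rintro rfl; exact hw hx
        · exact subset_of_eq rfl
      exact ⟨aux true, aux false⟩
    · unfold St
      rw [Finset.erase_insert hnot, ← Finset.image_erase sg_inj]
      congr 1
      · rw [Finset.image_insert, Finset.insert_eq, Finset.union_comm]; rfl
      · congr 1
        ext v; simp

lemma Span.percolates {ω : Om n} (h : Span ω Finset.univ) :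
    JPercolates 1 (edges true ω) (edges false ω) := by
  have := h.reach
  have e : St (Finset.univ : Finset (Fin n)) = {(Finset.univ : Finset (Fin n)).powersetCard 1} := by
    unfold St
    rw [Finset.powersetCard_one, Finset.map_eq_image]
    simp
  rw [e] at this
  exact this

/-- If there is a big seed and no big stuck set then we percolate. -/
lemma perc_of_seed {ω : Om n} {m : ℕ} (hseed : ∃ S, m ≤ S.card ∧ Span ω S)
    (hst : ¬ ∃ X : Finset (Fin n), (m ≤ X.card ∧ X ≠ Finset.univ) ∧
      Spanned ω X ∧ ∀ w ∈ Xᶜ, ¬ joined ω X w) :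
    JPercolates 1 (edges true ω) (edges false ω) := by
  have hne : ({S : Finset (Fin n) | m ≤ S.card ∧ Span ω S}).Nonempty := hseed
  obtain ⟨X, hX, hmax⟩ := Set.Finite.exists_maximalFor (fun S : Finset (Fin n) => S.card) _
    (Set.toFinite {S : Finset (Fin n) | m ≤ S.card ∧ Span ω S}) hne
  obtain ⟨hXm, hXs⟩ := hX
  by_cases hu : X = Finset.univ
  · subst hu; exact hXs.percolates
  · exfalso
    apply hst
    refine ⟨X, ⟨hXm, hu⟩, hXs.spanned, fun w hw hj => ?_⟩
    rw [Finset.mem_compl] at hw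
    have h1 := Span.step X w hXs hw hj
    have hc := Finset.card_insert_of_notMem hw
    have := hmax (j := insert w X) ⟨by omega, h1⟩ (by simp only; omega)
    simp only at this
    omega

end Jig

namespace Jig

variable {n : ℕ} {P : Bool → ℝ}

lemma pair_inj {x y w : Fin n} (hx : x ≠ w) (h : ({x, w} : Finset (Fin n)) = {y, w}) : x = y := by
  have : x ∈ ({y, w} : Finset (Fin n)) := by rw [← h]; simp
  simp at this
  tauto

lemma spanned_bound (hP : ∀ b, 0 ≤ P b ∧ P b ≤ 1) (S : Finset (Fin n)) :
    pr n P (fun ω => Spanned ω S)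
      ≤ ((S.card : ℝ) ^ (S.card - 1)) ^ 2 * (P true * P false) ^ (S.card - 1) := by
  classical
  rcases S.eq_empty_or_nonempty with rfl | ⟨r, hr⟩
  · refine (pr_le_one _).trans ?_
    simp
  set R := S.erase r with hR
  have hRc : R.card = S.card - 1 := Finset.card_erase_of_mem hr
  set F : Finset (Fin n → Fin n) := Fintype.piFinset (fun v => if v ∈ R then S else {v}) with hF
  have hFc : F.card = S.card ^ (S.card - 1) := by
    rw [hF, Fintype.card_piFinset, ← Finset.prod_subset (Finset.subset_univ R)]
    · rw [← hRc, ← Finset.prod_const]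
      exact Finset.prod_congr rfl fun v hv => by rw [if_pos hv]
    · intro v _ hv; simp [hv]
  set ed : Bool → (Fin n → Fin n) → Fin n → Bool × Finset (Fin n) :=
    fun b f v => (b, {v, f v}) with hed
  set Ev : (Fin n → Fin n) × (Fin n → Fin n) → Om n → Prop := fun fg ω =>
    (Set.InjOn (ed true fg.1) R ∧ Set.InjOn (ed false fg.2) R) ∧
      ∀ i ∈ R.image (ed true fg.1) ∪ R.image (ed false fg.2), ω i = true with hEv
  have h1 : pr n P (fun ω => Spanned ω S) ≤ pr n P (fun ω => ∃ fg ∈ F ×ˢ F, Ev fg ω) := by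
    apply pr_mono
    intro ω hω
    have aux : ∀ b, ∃ f ∈ F, Set.InjOn (ed b f) R ∧ ∀ i ∈ R.image (ed b f), ω i = true := by
      intro b
      obtain ⟨f, h, hf⟩ := hω.2 b r hr
      have hf' : ∀ v ∈ R, f v ∈ S ∧ ω (b, {v, f v}) = true ∧ h (f v) < h v := fun v hv =>
        hf v (Finset.mem_of_mem_erase hv) (Finset.ne_of_mem_erase hv)
      refine ⟨fun v => if v ∈ R then f v else v, ?_, ?_, ?_⟩
      · rw [hF, Fintype.mem_piFinset]
        intro v
        by_cases hv : v ∈ R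
        · simp [hv, (hf' v hv).1]
        · simp [hv]
      · intro v hv w hw he
        rw [Finset.mem_coe] at hv hw
        simp only [hed, hv, hw, if_true, Prod.mk.injEq, true_and] at he
        by_contra hne
        have m1 : v ∈ ({w, f w} : Finset (Fin n)) := by rw [← he]; simp
        have m2 : w ∈ ({v, f v} : Finset (Fin n)) := by rw [he]; simp
        simp only [Finset.mem_insert, Finset.mem_singleton] at m1 m2
        have e1 : v = f w := by tauto
        have e2 : w = f v := by
          rcases m2 with h | h
          · exact absurd h.symm hne
          · exact h
        have l1 := (hf' v hv).2.2
        have l2 := (hf' w hw).2.2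
        rw [← e2] at l1
        rw [← e1] at l2
        omega
      · intro i hi
        obtain ⟨v, hv, rfl⟩ := Finset.mem_image.1 hi
        simp only [hed, hv, if_true]
        exact (hf' v hv).2.1
    obtain ⟨f, hf, hf1, hf2⟩ := aux true
    obtain ⟨g, hg, hg1, hg2⟩ := aux false
    refine ⟨(f, g), Finset.mem_product.2 ⟨hf, hg⟩, ⟨hf1, hg1⟩, fun i hi => ?_⟩
    rcases Finset.mem_union.1 hi with h | h
    · exact hf2 i h
    · exact hg2 i h
  have h2 : ∀ fg ∈ F ×ˢ F, pr n P (Ev fg) ≤ (P true * P false) ^ (S.card - 1) := by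
    intro fg _
    by_cases hi : Set.InjOn (ed true fg.1) R ∧ Set.InjOn (ed false fg.2) R
    · refine (pr_mono (B := fun ω => ∀ i ∈ R.image (ed true fg.1) ∪ R.image (ed false fg.2),
        ω i = (fun _ => true) i) (fun ω h => h.2)).trans ?_
      rw [pr_cyl hP, Finset.prod_union, Finset.prod_image hi.1, Finset.prod_image hi.2]
      · simp [hed, hRc, mul_pow]
      · rw [Finset.disjoint_left]
        intro i h h'
        obtain ⟨v, _, rfl⟩ := Finset.mem_image.1 h
        obtain ⟨w, _, he⟩ := Finset.mem_image.1 h'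
        simp [hed] at he
    · have : pr n P (Ev fg) ≤ pr n P (fun _ => False) := pr_mono fun ω h => hi h.1
      refine this.trans ?_
      have : pr n P (fun _ => False) = 0 := by simp [pr]
      rw [this]
      exact pow_nonneg (mul_nonneg (hP _).1 (hP _).1) _
  refine (h1.trans (pr_ex _ _)).trans ((Finset.sum_le_sum h2).trans ?_)
  rw [Finset.sum_const, Finset.card_product, hFc, nsmul_eq_mul]
  push_cast
  rw [sq]

noncomputable def rho (P : Bool → ℝ) (x : ℕ) : ℝ :=
  (1 - (1 - P true) ^ x) * (1 - (1 - P false) ^ x)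

def Jset (b : Bool) (X : Finset (Fin n)) (w : Fin n) : Finset (Bool × Finset (Fin n)) :=
  X.image (fun x => (b, {x, w}))

def JJ (X : Finset (Fin n)) (w : Fin n) : Finset (Bool × Finset (Fin n)) :=
  Jset true X w ∪ Jset false X w

lemma mem_JJ {X : Finset (Fin n)} {w : Fin n} {i : Bool × Finset (Fin n)} :
    i ∈ JJ X w ↔ ∃ x ∈ X, i.2 = {x, w} := by
  simp only [JJ, Jset, Finset.mem_union, Finset.mem_image]
  constructor
  · rintro (⟨x, hx, rfl⟩ | ⟨x, hx, rfl⟩) <;> exact ⟨x, hx, rfl⟩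
  · rintro ⟨x, hx, h⟩
    obtain ⟨b, e⟩ := i
    simp only at h
    subst h
    cases b
    · right; exact ⟨x, hx, rfl⟩
    · left; exact ⟨x, hx, rfl⟩

lemma dep_joined (X : Finset (Fin n)) (w : Fin n) :
    Dep (JJ X w) (fun ω => joined ω X w) := by
  intro ω ω' h hj b
  obtain ⟨x, hx, he⟩ := hj b
  exact ⟨x, hx, by rw [← h _ (mem_JJ.2 ⟨x, hx, rfl⟩)]; exact he⟩

lemma pr_joined (hP : ∀ b, 0 ≤ P b ∧ P b ≤ 1) {X : Finset (Fin n)} {w : Fin n} (hw : w ∉ X) :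
    pr n P (fun ω => joined ω X w) = rho P X.card := by
  have one : ∀ b, pr n P (fun ω => ∃ x ∈ X, ω (b, {x, w}) = true) = 1 - (1 - P b) ^ X.card := by
    intro b
    have h := pr_cyl (n := n) hP (Jset b X w) (fun _ => false)
    have h' := pr_not (n := n) (P := P) (fun ω => ∃ x ∈ X, ω (b, {x, w}) = true)
    have e : pr n P (fun ω => ¬ ∃ x ∈ X, ω (b, {x, w}) = true)
        = pr n P (fun ω => ∀ i ∈ Jset b X w, ω i = false) := by
      apply pr_congr; intro ω; simp [Jset]
    rw [e, h, Jset, Finset.prod_image] at h'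
    · simp at h'; linarith
    · intro x hx y hy he
      simp only [Prod.mk.injEq, true_and] at he
      refine pair_inj ?_ he
      rintro rfl; exact hw hx
  have dep : ∀ b, Dep (Jset b X w) (fun ω => ∃ x ∈ X, ω (b, {x, w}) = true) := by
    rintro b ω ω' h ⟨x, hx, he⟩
    exact ⟨x, hx, by rw [← h _ (Finset.mem_image_of_mem _ hx)]; exact he⟩
  have := pr_and (P := P) (dep true) (dep false) (by
    rw [Finset.disjoint_left]
    intro i h h'
    obtain ⟨v, _, rfl⟩ := Finset.mem_image.1 h
    obtain ⟨w, _, he⟩ := Finset.mem_image.1 h'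
    simp at he)
  rw [one, one] at this
  rw [rho, ← this]
  apply pr_congr
  intro ω
  exact ⟨fun h => ⟨h true, h false⟩, fun h b => by cases b; exacts [h.2, h.1]⟩

lemma rho_nonneg (hP : ∀ b, 0 ≤ P b ∧ P b ≤ 1) (x : ℕ) : 0 ≤ rho P x := by
  unfold rho
  apply mul_nonneg
  · have := pow_le_one₀ (n := x) (show 0 ≤ 1 - P true by linarith [(hP true).2])
      (by linarith [(hP true).1]); linarith
  · have := pow_le_one₀ (n := x) (show 0 ≤ 1 - P false by linarith [(hP false).2])
      (by linarith [(hP false).1]); linarith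

lemma rho_le_one (hP : ∀ b, 0 ≤ P b ∧ P b ≤ 1) (x : ℕ) : rho P x ≤ 1 := by
  unfold rho
  have h1 := pow_nonneg (show 0 ≤ 1 - P true by linarith [(hP true).2]) x
  have h2 := pow_nonneg (show 0 ≤ 1 - P false by linarith [(hP false).2]) x
  have h3 := pow_le_one₀ (n := x) (show 0 ≤ 1 - P true by linarith [(hP true).2])
      (by linarith [(hP true).1])
  have h4 := pow_le_one₀ (n := x) (show 0 ≤ 1 - P false by linarith [(hP false).2])
      (by linarith [(hP false).1])
  apply mul_le_one₀ <;> linarith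

def noW (w : Fin n) : Finset (Bool × Finset (Fin n)) := Finset.univ.filter (fun i => w ∉ i.2)

lemma stuck_eq (hP : ∀ b, 0 ≤ P b ∧ P b ≤ 1) (X W : Finset (Fin n)) (hd : Disjoint X W) :
    pr n P (fun ω => Spanned ω X ∧ ∀ w ∈ W, ¬ joined ω X w)
      = pr n P (fun ω => Spanned ω X) * (1 - rho P X.card) ^ W.card := by
  induction W using Finset.induction_on with
  | empty => simp
  | insert w W hw ih =>
    have hwX : w ∉ X := fun h => Finset.disjoint_left.1 hd h (Finset.mem_insert_self _ _)
    have d1 : Dep (noW w) (fun ω => Spanned ω X ∧ ∀ w ∈ W, ¬ joined ω X w) := by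
      rintro ω ω' h ⟨⟨hne, hs⟩, hj⟩
      refine ⟨⟨hne, fun b r hr => ?_⟩, fun v hv hjj => hj v hv ?_⟩
      · obtain ⟨f, k, hf⟩ := hs b r hr
        refine ⟨f, k, fun v hv hvr => ?_⟩
        obtain ⟨h1, h2, h3⟩ := hf v hv hvr
        refine ⟨h1, ?_, h3⟩
        rw [← h]
        · exact h2
        · simp only [noW, Finset.mem_filter, Finset.mem_univ, true_and, Finset.mem_insert,
            Finset.mem_singleton, not_or]
          constructor
          · rintro rfl; exact hwX hv
          · intro e; rw [← e] at h1; exact hwX h1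
      · intro b
        obtain ⟨x, hx, he⟩ := hjj b
        refine ⟨x, hx, ?_⟩
        rw [h]
        · exact he
        · simp only [noW, Finset.mem_filter, Finset.mem_univ, true_and, Finset.mem_insert,
            Finset.mem_singleton, not_or]
          constructor
          · rintro rfl; exact hwX hx
          · rintro rfl; exact hw hv
    have d2 := (dep_joined X w).not
    have := pr_and (P := P) d1 d2 (by
      rw [Finset.disjoint_left]
      intro i hi hi'
      obtain ⟨x, hx, e⟩ := mem_JJ.1 hi'
      simp [noW, e] at hi)
    rw [Finset.card_insert_of_notMem hw, pow_succ, ← mul_assoc, ← ih (hd.mono_right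
      (Finset.subset_insert _ _)), ← pr_joined hP hwX, ← pr_not, ← this]
    apply pr_congr
    intro ω
    simp only [Finset.forall_mem_insert]
    tauto

end Jig

namespace Jig

variable {n : ℕ} {P : Bool → ℝ}

def cell (blk : Fin n → ℕ) (W : Finset (Fin n)) (k : ℕ) : Finset (Fin n) :=
  W.filter (fun v => blk v = k)

inductive Reach (m : ℕ) (blk : Fin n → ℕ) (ω : Om n) :
    Finset (Fin n) → Finset (Fin n) → Finset (Fin n) → Prop
  | done (X A W : Finset (Fin n)) : m ≤ X.card → Reach m blk ω X A W
  | hit (X A W : Finset (Fin n)) (w : Fin n) : w ∈ A → joined ω X w →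
      Reach m blk ω (insert w X) (cell blk (W.erase w) (X.card + 1)) (W.erase w) →
      Reach m blk ω X A W
  | drop (X A W : Finset (Fin n)) (w : Fin n) : Reach m blk ω X (A.erase w) W →
      Reach m blk ω X A W
  | restart (X A W : Finset (Fin n)) : Reach m blk ω ∅ ∅ W → Reach m blk ω X A W
  | start (W : Finset (Fin n)) (v : Fin n) : v ∈ W →
      Reach m blk ω {v} (cell blk (W.erase v) 1) (W.erase v) → Reach m blk ω ∅ ∅ W

lemma cell_subset (blk : Fin n → ℕ) (W : Finset (Fin n)) (k : ℕ) : cell blk W k ⊆ W :=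
  Finset.filter_subset _ _

lemma Reach.sound {m : ℕ} (hm : 1 ≤ m) {blk : Fin n → ℕ} {ω : Om n} {X A W : Finset (Fin n)}
    (h : Reach m blk ω X A W) (hX : X = ∅ ∨ Span ω X) (hA : A ⊆ W) (hd : Disjoint X W) :
    ∃ S, m ≤ S.card ∧ Span ω S := by
  induction h with
  | done X A W h =>
    rcases hX with rfl | hX
    · simp at h; omega
    · exact ⟨X, h, hX⟩
  | hit X A W w hw hj _ ih =>
    have hwX : w ∉ X := fun h => Finset.disjoint_left.1 hd h (hA hw)
    apply ih
    · right
      rcases hX with rfl | hX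
      · obtain ⟨x, hx, _⟩ := hj true
        simp at hx
      · exact Span.step X w hX hwX hj
    · exact cell_subset _ _ _
    · rw [Finset.disjoint_insert_left]
      exact ⟨by simp, hd.mono_right (Finset.erase_subset _ _)⟩
  | drop X A W w _ ih => exact ih hX ((Finset.erase_subset _ _).trans hA) hd
  | restart X A W _ ih => exact ih (Or.inl rfl) (by simp) (by simp)
  | start W v hv _ ih =>
    exact ih (Or.inr (Span.single v)) (cell_subset _ _ _) (by simp)

open scoped Classical in
noncomputable def DD (blk : Fin n → ℕ) (X A W : Finset (Fin n)) :
    Finset (Bool × Finset (Fin n)) :=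
  Finset.univ.filter (fun i => (∃ x ∈ X, ∃ w ∈ W, (w ∈ A ∨ X.card < blk w) ∧ i.2 = {x, w}) ∨
    (∃ u ∈ W, ∃ w ∈ W, i.2 = {u, w}))

lemma mem_DD {blk : Fin n → ℕ} {X A W : Finset (Fin n)} {i : Bool × Finset (Fin n)} :
    i ∈ DD blk X A W ↔ (∃ x ∈ X, ∃ w ∈ W, (w ∈ A ∨ X.card < blk w) ∧ i.2 = {x, w}) ∨
    (∃ u ∈ W, ∃ w ∈ W, i.2 = {u, w}) := by
  simp [DD]

lemma dep_reach (m : ℕ) (blk : Fin n → ℕ) (X A W : Finset (Fin n)) (hA : A ⊆ W)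
    (hd : Disjoint X W) :
    Dep (DD blk X A W) (fun ω => Reach m blk ω X A W) := by
  intro ω ω' hag h
  induction h with
  | done X A W h => exact Reach.done X A W h
  | hit X A W w hw hj _ ih =>
    have hwX : w ∉ X := fun h => Finset.disjoint_left.1 hd h (hA hw)
    refine Reach.hit X A W w hw ?_ ?_
    · intro b
      obtain ⟨x, hx, he⟩ := hj b
      refine ⟨x, hx, ?_⟩
      rw [← hag]
      · exact he
      · exact mem_DD.2 (Or.inl ⟨x, hx, w, hA hw, Or.inl hw, rfl⟩)
    · apply ih
      · exact cell_subset _ _ _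
      · rw [Finset.disjoint_insert_left]
        exact ⟨by simp, hd.mono_right (Finset.erase_subset _ _)⟩
      · intro i hi
        apply hag
        rw [mem_DD] at hi ⊢
        rcases hi with ⟨x, hx, u, hu, hor, e⟩ | ⟨u, hu, v, hv, e⟩
        · rcases Finset.mem_insert.1 hx with rfl | hx
          · exact Or.inr ⟨x, hA hw, u, Finset.mem_of_mem_erase hu, e⟩
          · refine Or.inl ⟨x, hx, u, Finset.mem_of_mem_erase hu, Or.inr ?_, e⟩
            rcases hor with h | h
            · have := (Finset.mem_filter.1 h).2
              omega
            · rw [Finset.card_insert_of_notMem hwX] at h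
              omega
        · exact Or.inr ⟨u, Finset.mem_of_mem_erase hu, v, Finset.mem_of_mem_erase hv, e⟩
  | drop X A W w _ ih =>
    refine Reach.drop X A W w (ih ((Finset.erase_subset _ _).trans hA) hd ?_)
    intro i hi
    apply hag
    rw [mem_DD] at hi ⊢
    rcases hi with ⟨x, hx, u, hu, hor, e⟩ | h
    · exact Or.inl ⟨x, hx, u, hu, hor.imp_left Finset.mem_of_mem_erase, e⟩
    · exact Or.inr h
  | restart X A W _ ih =>
    refine Reach.restart X A W (ih (by simp) (by simp) ?_)
    intro i hi
    apply hag
    rw [mem_DD] at hi ⊢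
    rcases hi with ⟨x, hx, _⟩ | h
    · simp at hx
    · exact Or.inr h
  | start W v hv _ ih =>
    refine Reach.start W v hv (ih (cell_subset _ _ _) (by simp) ?_)
    intro i hi
    apply hag
    rw [mem_DD] at hi ⊢
    rcases hi with ⟨x, hx, u, hu, hor, e⟩ | ⟨u, hu, w, hw, e⟩
    · rw [Finset.mem_singleton] at hx
      subst hx
      exact Or.inr ⟨x, hv, u, Finset.mem_of_mem_erase hu, e⟩
    · exact Or.inr ⟨u, Finset.mem_of_mem_erase hu, w, Finset.mem_of_mem_erase hw, e⟩

noncomputable def fl (P : Bool → ℝ) (m : ℕ) (blk : Fin n → ℕ) (X A W : Finset (Fin n)) : ℝ :=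
  pr n P (fun ω => ¬ Reach m blk ω X A W)

lemma fl_step (hP : ∀ b, 0 ≤ P b ∧ P b ≤ 1) (m : ℕ) (blk : Fin n → ℕ) (X A W : Finset (Fin n))
    (hA : A ⊆ W) (hA' : ∀ w ∈ A, blk w = X.card) (hd : Disjoint X W) (w : Fin n) (hw : w ∈ A) :
    fl P m blk X A W ≤
      rho P X.card * fl P m blk (insert w X) (cell blk (W.erase w) (X.card + 1)) (W.erase w)
      + (1 - rho P X.card) * fl P m blk X (A.erase w) W := by
  have hwX : w ∉ X := fun h => Finset.disjoint_left.1 hd h (hA hw)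
  have hdis : ∀ x ∈ X, x ∉ W := fun x hx => Finset.disjoint_left.1 hd hx
  have e1 := pr_and (P := P) (dep_joined X w) (dep_reach m blk (insert w X)
    (cell blk (W.erase w) (X.card + 1)) (W.erase w) (cell_subset _ _ _) (by
      rw [Finset.disjoint_insert_left]
      exact ⟨by simp, hd.mono_right (Finset.erase_subset _ _)⟩)).not (by
    rw [Finset.disjoint_left]
    intro i hi hi'
    obtain ⟨x, hx, e⟩ := mem_JJ.1 hi
    rw [mem_DD] at hi'
    rcases hi' with ⟨y, hy, u, hu, hor, e'⟩ | ⟨u, hu, v, hv, e'⟩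
    · have : u ∈ ({x, w} : Finset (Fin n)) := by rw [← e, e']; simp
      simp only [Finset.mem_insert, Finset.mem_singleton] at this
      rcases this with rfl | rfl
      · exact hdis _ hx (Finset.mem_of_mem_erase hu)
      · simp at hu
    · have : w ∈ ({u, v} : Finset (Fin n)) := by rw [← e', e]; simp
      simp only [Finset.mem_insert, Finset.mem_singleton] at this
      rcases this with rfl | rfl
      · simp at hu
      · simp at hv)
  have e2 := pr_and (P := P) (dep_joined X w).not (dep_reach m blk X (A.erase w) W
    ((Finset.erase_subset _ _).trans hA) hd).not (by
    rw [Finset.disjoint_left]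
    intro i hi hi'
    obtain ⟨x, hx, e⟩ := mem_JJ.1 hi
    rw [mem_DD] at hi'
    rcases hi' with ⟨y, hy, u, hu, hor, e'⟩ | ⟨u, hu, v, hv, e'⟩
    · have : u ∈ ({x, w} : Finset (Fin n)) := by rw [← e, e']; simp
      simp only [Finset.mem_insert, Finset.mem_singleton] at this
      rcases this with rfl | rfl
      · exact hdis _ hx hu
      · rcases hor with h | h
        · simp at h
        · rw [hA' _ hw] at h; omega
    · have : x ∈ ({u, v} : Finset (Fin n)) := by rw [← e', e]; simp
      simp only [Finset.mem_insert, Finset.mem_singleton] at this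
      rcases this with rfl | rfl
      · exact hdis _ hx hu
      · exact hdis _ hx hv)
  rw [pr_not, pr_joined hP hwX] at e2
  rw [pr_joined hP hwX] at e1
  unfold fl
  rw [← e1, ← e2]
  refine (pr_mono ?_).trans (pr_or _ _)
  intro ω h
  by_cases hj : joined ω X w
  · left; exact ⟨hj, fun hr => h (Reach.hit X A W w hw hj hr)⟩
  · right; exact ⟨hj, fun hr => h (Reach.drop X A W w hr)⟩

lemma fl_stage (hP : ∀ b, 0 ≤ P b ∧ P b ≤ 1) (m : ℕ) (blk : Fin n → ℕ) (X W : Finset (Fin n))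
    (hd : Disjoint X W) (a b : ℝ)
    (ha : ∀ w ∈ W, blk w = X.card →
      fl P m blk (insert w X) (cell blk (W.erase w) (X.card + 1)) (W.erase w) ≤ a)
    (hb : fl P m blk ∅ ∅ W ≤ b) :
    ∀ (k : ℕ) (A : Finset (Fin n)), A.card = k → A ⊆ W → (∀ w ∈ A, blk w = X.card) →
      fl P m blk X A W ≤ a + (1 - rho P X.card) ^ k * (b - a) := by
  intro k
  induction k with
  | zero =>
    intro A hA _ _
    have : fl P m blk X A W ≤ fl P m blk ∅ ∅ W :=
      pr_mono fun ω h hr => h (Reach.restart X A W hr)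
    simp; linarith
  | succ k ih =>
    intro A hAc hA hA'
    obtain ⟨w, hw⟩ : A.Nonempty := by rw [← Finset.card_pos]; omega
    have h1 := fl_step hP m blk X A W hA hA' hd w hw
    have h2 := ih (A.erase w) (by rw [Finset.card_erase_of_mem hw]; omega)
      ((Finset.erase_subset _ _).trans hA) (fun v hv => hA' v (Finset.mem_of_mem_erase hv))
    have h3 := ha w (hA hw) (hA' w hw)
    have r0 := rho_nonneg hP X.card
    have r1 := rho_le_one hP X.card
    calc _ ≤ _ := h1
      _ ≤ rho P X.card * a + (1 - rho P X.card) * (a + (1 - rho P X.card) ^ k * (b - a)) := by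
        have := sub_nonneg.2 r1
        gcongr
      _ = _ := by ring

lemma cell_erase_card (blk : Fin n → ℕ) (W : Finset (Fin n)) (w : Fin n) (j : ℕ) :
    (cell blk W j).card ≤ (cell blk (W.erase w) j).card + 1 ∧
    (blk w ≠ j → (cell blk (W.erase w) j) = cell blk W j) := by
  have e : cell blk (W.erase w) j = (cell blk W j).erase w := by
    ext v; simp [cell]; tauto
  constructor
  · rw [e]
    have := Finset.pred_card_le_card_erase (s := cell blk W j) (a := w)
    omega
  · intro h
    rw [e, Finset.erase_eq_of_notMem]
    simp [cell]; tauto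

lemma fl_chain (hP : ∀ b, 0 ≤ P b ∧ P b ≤ 1) (m : ℕ) (blk : Fin n → ℕ) (M s : ℕ) (q : ℕ → ℝ)
    (hq0 : ∀ j, 0 ≤ q j)
    (hq : ∀ j, 1 ≤ j → j < m → (1 - rho P j) ^ M ≤ 1 - q j) (B : ℝ) (hB0 : 0 ≤ B)
    (hB : ∀ W, (∀ j < m, M + s ≤ (cell blk W j).card) → fl P m blk ∅ ∅ W ≤ B) :
    ∀ (d k : ℕ) (X W : Finset (Fin n)), k + d = m → 1 ≤ k → X.card = k → Disjoint X W →
      (∀ j < m, M + s ≤ (cell blk W j).card) →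
      (∀ j < m, k ≤ j → M + s + 1 ≤ (cell blk W j).card) →
      fl P m blk X (cell blk W k) W ≤ (1 - ∏ j ∈ Finset.Ico k m, q j) * B := by
  intro d
  induction d with
  | zero =>
    intro k X W hk _ hX _ _ _
    have : fl P m blk X (cell blk W k) W = 0 := by
      unfold fl
      rw [pr_not]
      have : pr n P (fun ω => Reach m blk ω X (cell blk W k) W) = pr n P (fun _ => True) :=
        pr_congr fun ω => ⟨fun _ => trivial, fun _ => Reach.done _ _ _ (by omega)⟩
      rw [this]
      simp [pr]
    rw [this]
    have : k = m := by omega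
    subst this
    simp
  | succ d ih =>
    intro k X W hk hk1 hX hd hW1 hW2
    have hkm : k < m := by omega
    set Q := ∏ j ∈ Finset.Ico (k + 1) m, q j with hQ
    have hQ0 : 0 ≤ Q := Finset.prod_nonneg fun j _ => hq0 j
    have hst := fl_stage hP m blk X W hd ((1 - Q) * B) B (by
      intro w hw hbw
      rw [hX]
      have hwX : w ∉ X := fun h => Finset.disjoint_left.1 hd h hw
      apply ih (k + 1) (insert w X) (W.erase w) (by omega) (by omega)
      · rw [Finset.card_insert_of_notMem hwX, hX]
      · rw [Finset.disjoint_insert_left]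
        exact ⟨by simp, hd.mono_right (Finset.erase_subset _ _)⟩
      · intro j hj
        by_cases hjk : j = k
        · have := hW2 j hj (by omega)
          have := (cell_erase_card blk W w j).1
          omega
        · rw [(cell_erase_card blk W w j).2 (by omega)]
          exact hW1 j hj
      · intro j hj hjk
        rw [(cell_erase_card blk W w j).2 (by omega)]
        exact hW2 j hj (by omega)) (hB W hW1) _ (cell blk W k) rfl (cell_subset _ _ _) (by
      intro w hw
      rw [hX]; exact (Finset.mem_filter.1 hw).2)
    refine hst.trans ?_
    rw [hX]
    have r0 := rho_nonneg hP k
    have r1 := rho_le_one hP k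
    have hpow : (1 - rho P k) ^ (cell blk W k).card ≤ 1 - q k := by
      refine le_trans ?_ (hq k hk1 hkm)
      apply pow_le_pow_of_le_one (by linarith) (by linarith)
      have := hW1 k hkm
      omega
    rw [Finset.prod_eq_prod_Ico_succ_bot hkm, ← hQ]
    have : (1 - rho P k) ^ (cell blk W k).card * (B - (1 - Q) * B) ≤
        (1 - q k) * (B - (1 - Q) * B) := by
      apply mul_le_mul_of_nonneg_right hpow
      nlinarith [mul_nonneg hQ0 hB0]
    linarith [this, show (1 - Q) * B + (1 - q k) * (B - (1 - Q) * B) = (1 - q k * Q) * B by ring]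

lemma fl_main (hP : ∀ b, 0 ≤ P b ∧ P b ≤ 1) (m : ℕ) (hm : 1 ≤ m) (blk : Fin n → ℕ) (M : ℕ)
    (q : ℕ → ℝ)
    (hq0 : ∀ j, 0 ≤ q j) (hq1 : ∀ j, q j ≤ 1)
    (hq : ∀ j, 1 ≤ j → j < m → (1 - rho P j) ^ M ≤ 1 - q j) :
    ∀ (t : ℕ) (W : Finset (Fin n)), (∀ j < m, M + t ≤ (cell blk W j).card) →
      fl P m blk ∅ ∅ W ≤ (1 - ∏ j ∈ Finset.Ico 1 m, q j) ^ t := by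
  intro t
  have hQ1 : ∏ j ∈ Finset.Ico 1 m, q j ≤ 1 := Finset.prod_le_one (fun j _ => hq0 j) fun j _ => hq1 j
  induction t with
  | zero => intro W _; rw [pow_zero]; exact pr_le_one _
  | succ s ih =>
    intro W hW
    obtain ⟨v, hv⟩ : (cell blk W 0).Nonempty := by
      rw [← Finset.card_pos]; have := hW 0 (by omega); omega
    have hvW := cell_subset _ _ _ hv
    have hv0 : blk v = 0 := (Finset.mem_filter.1 hv).2
    have h1 : fl P m blk ∅ ∅ W ≤ fl P m blk {v} (cell blk (W.erase v) 1) (W.erase v) :=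
      pr_mono fun ω h hr => h (Reach.start W v hvW hr)
    refine h1.trans ?_
    rw [pow_succ, mul_comm]
    apply fl_chain hP m blk M s q hq0 hq _ (pow_nonneg (by linarith) _) ih (m - 1) 1 {v}
      (W.erase v) (by omega) le_rfl (by simp) (by simp)
    · intro j hj
      have := hW j hj
      have := (cell_erase_card blk W v j).1
      omega
    · intro j hj hj1
      rw [(cell_erase_card blk W v j).2 (by omega)]
      have := hW j hj
      omega

lemma seed_main (hP : ∀ b, 0 ≤ P b ∧ P b ≤ 1) (m : ℕ) (hm : 1 ≤ m) (M t : ℕ) (q : ℕ → ℝ)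
    (hq0 : ∀ j, 0 ≤ q j) (hq1 : ∀ j, q j ≤ 1)
    (hq : ∀ j, 1 ≤ j → j < m → (1 - rho P j) ^ M ≤ 1 - q j) (hn : m * (M + t) ≤ n) :
    pr n P (fun ω => ¬ ∃ S, m ≤ S.card ∧ Span ω S) ≤ (1 - ∏ j ∈ Finset.Ico 1 m, q j) ^ t := by
  have h := fl_main hP m hm (fun v : Fin n => (v : ℕ) % m) M q hq0 hq1 hq t Finset.univ (by
    intro j hj
    have hlt : ∀ i : Fin (M + t), m * (i : ℕ) + j < n := by
      intro i
      have : m * ((i : ℕ) + 1) ≤ m * (M + t) := Nat.mul_le_mul_left _ i.2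
      rw [Nat.mul_add] at this
      omega
    have := Finset.card_le_card_of_injOn (s := (Finset.univ : Finset (Fin (M + t))))
      (t := cell (fun v : Fin n => (v : ℕ) % m) Finset.univ j)
      (fun i => (⟨m * (i : ℕ) + j, hlt i⟩ : Fin n)) (by
        intro i _
        simp [cell, Nat.mod_eq_of_lt hj]) (by
        intro i _ i' _ he
        simp only [Fin.mk.injEq, Nat.add_right_cancel_iff] at he
        exact Fin.ext (Nat.eq_of_mul_eq_mul_left hm he))
    simpa using this)
  refine le_trans (pr_mono ?_) h
  intro ω hno hr
  exact hno (hr.sound hm (Or.inl rfl) (by simp) (by simp))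

end Jig

namespace Jig

variable {n : ℕ} {P : Bool → ℝ}

lemma choose_bound (n x : ℕ) (hx : 1 ≤ x) {q : ℝ} (hq : 0 ≤ q) :
    (n.choose x : ℝ) * (((x : ℝ) ^ (x - 1)) ^ 2 * q ^ (x - 1)) ≤
      n * Real.exp 1 * (Real.exp 1 * n * x * q) ^ (x - 1) := by
  obtain ⟨y, rfl⟩ : ∃ y, x = y + 1 := ⟨x - 1, by omega⟩
  simp only [Nat.add_sub_cancel]
  have h1 : (n.choose (y + 1) : ℝ) ≤ (n : ℝ) ^ (y + 1) / ((y + 1).factorial : ℝ) :=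
    Nat.choose_le_pow_div (y + 1) n
  set X : ℝ := ((y + 1 : ℕ) : ℝ) with hX
  have hX1 : 1 ≤ X := by rw [hX]; push_cast; linarith [(Nat.cast_nonneg y : (0:ℝ) ≤ y)]
  have h2 : X ^ (y + 1) / ((y + 1).factorial : ℝ) ≤ Real.exp X :=
    Real.pow_div_factorial_le_exp X (by linarith) _
  have h3 : Real.exp X = Real.exp 1 ^ (y + 1) := by rw [hX, Real.exp_one_pow]
  have hf : (0 : ℝ) < ((y + 1).factorial : ℝ) := by positivity
  calc (n.choose (y + 1) : ℝ) * ((X ^ y) ^ 2 * q ^ y)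
      ≤ (n : ℝ) ^ (y + 1) / ((y + 1).factorial : ℝ) * ((X ^ (y + 1) * X ^ y) * q ^ y) := by
        rw [sq]
        gcongr
        omega
    _ = (n : ℝ) ^ (y + 1) * (X ^ (y + 1) / ((y + 1).factorial : ℝ)) * (X ^ y * q ^ y) := by
        field_simp
    _ ≤ (n : ℝ) ^ (y + 1) * (Real.exp 1 ^ (y + 1)) * (X ^ y * q ^ y) := by
        rw [← h3]; gcongr
    _ = _ := by ring

lemma one_sub_exp_ge {u : ℝ} (hu : 0 ≤ u) : u / (1 + u) ≤ 1 - Real.exp (-u) := by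
  have h := Real.add_one_le_exp u
  have : Real.exp (-u) ≤ 1 / (1 + u) := by
    rw [Real.exp_neg, ← one_div]
    apply one_div_le_one_div_of_le <;> linarith
  have e : u / (1 + u) = 1 - 1 / (1 + u) := by field_simp; ring
  linarith

lemma pow_le_exp {p : ℝ} (hp : p ≤ 1) (x : ℕ) : (1 - p) ^ x ≤ Real.exp (-(p * x)) := by
  have h := Real.add_one_le_exp (-p)
  calc (1 - p) ^ x ≤ (Real.exp (-p)) ^ x := by
        apply pow_le_pow_left₀ (by linarith); linarith
    _ = _ := by rw [← Real.exp_nat_mul]; ring_nf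

lemma half_of_le {p : ℝ} (h0 : 0 ≤ p) (hp : p ≤ 1) (x : ℕ) (hpx : p * x ≤ 1) :
    p * x / 2 ≤ 1 - (1 - p) ^ x := by
  have h1 := pow_le_exp hp x
  have hu : 0 ≤ p * x := by positivity
  have h2 := one_sub_exp_ge hu
  have : p * x / 2 ≤ p * x / (1 + p * x) := by
    apply div_le_div_of_nonneg_left hu <;> linarith
  linarith

lemma half_of_ge {p : ℝ} (hp : p ≤ 1) (x : ℕ) (hpx : 1 ≤ p * x) :
    1 / 2 ≤ 1 - (1 - p) ^ x := by
  have h1 := pow_le_exp hp x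
  have h2 := one_sub_exp_ge (show 0 ≤ p * x by linarith)
  have : 1 / 2 ≤ p * x / (1 + p * x) := by
    rw [div_le_div_iff₀] <;> linarith
  linarith

lemma one_sub_rho_le (hP : ∀ b, 0 ≤ P b ∧ P b ≤ 1) (x : ℕ) :
    1 - rho P x ≤ Real.exp (-(P true * x)) + Real.exp (-(P false * x)) := by
  have h1 := pow_le_exp (hP true).2 x
  have h2 := pow_le_exp (hP false).2 x
  have a1 := pow_nonneg (show 0 ≤ 1 - P true by linarith [(hP true).2]) x
  have a2 := pow_nonneg (show 0 ≤ 1 - P false by linarith [(hP false).2]) x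
  unfold rho
  nlinarith [mul_nonneg a1 a2]

lemma choose_le_exp {n x : ℕ} (hn : 1 ≤ n) : (n.choose x : ℝ) ≤ Real.exp (Real.log n * x) := by
  have h : (n.choose x : ℝ) ≤ (n : ℝ) ^ x := by exact_mod_cast Nat.choose_le_pow n x
  have hn' : (0 : ℝ) < n := by exact_mod_cast hn
  rw [mul_comm, Real.exp_nat_mul, Real.exp_log hn']
  exact h

/-- standing assumptions -/
structure Hyp (n : ℕ) (P : Bool → ℝ) : Prop where
  hP : ∀ b, 0 ≤ P b ∧ P b ≤ 1
  hL : 2 ≤ Real.log n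
  hn : 10 ^ 12 * Real.log n ^ 3 ≤ n
  hlow : ∀ b, 10 ^ 12 * Real.log n / n ≤ P b
  hprod : P true * P false = 10 ^ 12 / (n * Real.log n)

lemma Hyp.npos (H : Hyp n P) : (0 : ℝ) < n := by
  have := H.hL
  have h := H.hn
  have : 0 < Real.log n ^ 3 := by positivity
  linarith

lemma pow_le_exp_of {r a : ℝ} (h0 : 0 ≤ 1 - r) (hr : a ≤ r) (k : ℕ) {z : ℝ} (ha : 0 ≤ a)
    (hk : z ≤ (k : ℝ)) : (1 - r) ^ k ≤ Real.exp (-(a * z)) := by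
  refine (pow_le_exp (by linarith) k).trans ?_
  apply Real.exp_le_exp.2
  have : a * z ≤ r * k := by
    calc a * z ≤ a * k := by gcongr
      _ ≤ r * k := by gcongr
  linarith

lemma stuck_caseA (H : Hyp n P) {x : ℕ} (hx : x < n) (hxn : (n : ℝ) ≤ 2 * x) :
    (n.choose x : ℝ) * (1 - rho P x) ^ (n - x) ≤ Real.exp (-2 * Real.log n) := by
  have np := H.npos
  have hL := H.hL
  set L := Real.log n with hLd
  have hu : ∀ b, 5 * L + 1 ≤ P b * x := by
    intro b
    have h1 := H.hlow b
    calc 5 * L + 1 ≤ 10 ^ 12 * L / n * (n / 2) := by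
          field_simp; nlinarith
      _ ≤ P b * x := by
          apply mul_le_mul h1 (by linarith) (by positivity) (H.hP b).1
  have h1 : 1 - rho P x ≤ Real.exp (-(5 * L)) := by
    refine (one_sub_rho_le H.hP x).trans ?_
    have e : ∀ b, Real.exp (-(P b * x)) ≤ Real.exp (-(5 * L)) / 2 := by
      intro b
      have : Real.exp (-(P b * x)) ≤ Real.exp (-(5 * L) + -1) :=
        Real.exp_le_exp.2 (by linarith [hu b])
      rw [Real.exp_add] at this
      have h2 : Real.exp (-1) ≤ 1 / 2 := by
        have := one_sub_exp_ge (show (0:ℝ) ≤ 1 by norm_num)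
        linarith
      have : Real.exp (-(5 * L)) * Real.exp (-1) ≤ Real.exp (-(5 * L)) * (1 / 2) := by gcongr
      linarith
    linarith [e true, e false]
  have r1 := rho_le_one H.hP x
  have hc : (n.choose x : ℝ) ≤ Real.exp (L * (n - x : ℕ)) := by
    rw [← Nat.choose_symm hx.le]
    exact choose_le_exp (by omega)
  have hy : (1 : ℝ) ≤ (n - x : ℕ) := by exact_mod_cast (by omega : 1 ≤ n - x)
  calc (n.choose x : ℝ) * (1 - rho P x) ^ (n - x)
      ≤ Real.exp (L * (n - x : ℕ)) * (Real.exp (-(5 * L))) ^ (n - x) := by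
        have : 0 ≤ 1 - rho P x := by linarith
        gcongr
    _ = Real.exp (-(4 * L) * (n - x : ℕ)) := by
        rw [← Real.exp_nat_mul, ← Real.exp_add]; ring_nf
    _ ≤ _ := by
        apply Real.exp_le_exp.2
        nlinarith

lemma stuck_caseB1 (H : Hyp n P) {x : ℕ} (hx : Real.log n ≤ x) (hxn : 2 * (x : ℝ) < n)
    (h1 : P true * x ≤ 1) (h2 : P false * x ≤ 1) :
    (n.choose x : ℝ) * (((x : ℝ) ^ (x - 1)) ^ 2 * (P true * P false) ^ (x - 1)) *
      (1 - rho P x) ^ (n - x) ≤ Real.exp (-2 * Real.log n) := by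
  have np := H.npos
  have hL := H.hL
  set L := Real.log n with hLd
  have hx1 : 1 ≤ x := by
    have : (0 : ℝ) < x := by linarith
    exact_mod_cast this
  have hxn' : x < n := by
    have : (x : ℝ) < n := by linarith
    exact_mod_cast this
  have hr : 10 ^ 12 * x ^ 2 / (4 * (n * L)) ≤ rho P x := by
    have a1 := half_of_le (H.hP true).1 (H.hP true).2 x h1
    have a2 := half_of_le (H.hP false).1 (H.hP false).2 x h2
    have b1 := (H.hP true).1
    have b2 := (H.hP false).1
    unfold rho
    calc 10 ^ 12 * (x : ℝ) ^ 2 / (4 * (n * L)) = (10 ^ 12 / (n * L)) * x ^ 2 / 4 := by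
          field_simp
      _ = (P true * x / 2) * (P false * x / 2) := by rw [← H.hprod]; ring
      _ ≤ _ := by
          apply mul_le_mul a1 a2 (by positivity)
          refine le_trans ?_ a1
          positivity
  have r1 := rho_le_one H.hP x
  have hcast : ((n - x : ℕ) : ℝ) = n - x := by push_cast [Nat.cast_sub hxn'.le]; ring
  have hp := pow_le_exp_of (by linarith) hr (n - x) (z := n / 2) (by positivity)
    (by rw [hcast]; linarith)
  have hcb := choose_bound n x hx1 (mul_nonneg (H.hP true).1 (H.hP false).1)
  have hxpos : (0 : ℝ) < x := by linarith
  set w : ℝ := x / L with hw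
  have hw1 : 1 ≤ w := by rw [hw, le_div_iff₀ (by linarith)]; linarith
  have hw0 : 0 < w := by linarith
  have e1 : Real.exp 1 * n * x * (P true * P false) = Real.exp 1 * (10 ^ 12 * w) := by
    rw [H.hprod, ← hLd, hw]; field_simp
  have e2 : Real.exp 1 * (10 ^ 12 * w) ≤ Real.exp (10 ^ 12 * w / 16) := by
    have := Real.quadratic_le_exp_of_nonneg (show 0 ≤ 10 ^ 12 * w / 16 by positivity)
    have he := Real.exp_one_lt_d9
    nlinarith
  have e3 : (Real.exp 1 * (10 ^ 12 * w)) ^ (x - 1) ≤ Real.exp (10 ^ 12 * w / 16 * x) := by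
    calc _ ≤ (Real.exp (10 ^ 12 * w / 16)) ^ (x - 1) := by gcongr
      _ = Real.exp ((x - 1 : ℕ) * (10 ^ 12 * w / 16)) := by rw [← Real.exp_nat_mul]
      _ ≤ _ := by
        apply Real.exp_le_exp.2
        rw [mul_comm]
        gcongr
        omega
  have e4 : 10 ^ 12 * (x : ℝ) ^ 2 / (4 * (n * L)) * (n / 2) = 10 ^ 12 * w / 8 * x := by
    rw [hw]; field_simp; ring
  rw [e4] at hp
  calc _ ≤ (n * Real.exp 1 * (Real.exp 1 * n * x * (P true * P false)) ^ (x - 1)) *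
        Real.exp (-(10 ^ 12 * w / 8 * x)) := by
        exact mul_le_mul hcb hp (pow_nonneg (by linarith) _) (by rw [e1]; positivity)
    _ ≤ (Real.exp L * Real.exp 1 * Real.exp (10 ^ 12 * w / 16 * x)) *
        Real.exp (-(10 ^ 12 * w / 8 * x)) := by
        rw [e1, hLd, Real.exp_log np]
        gcongr
    _ = Real.exp (L + 1 + 10 ^ 12 * w / 16 * x - 10 ^ 12 * w / 8 * x) := by
        rw [← Real.exp_add, ← Real.exp_add, ← Real.exp_add]; ring_nf
    _ ≤ _ := by
        apply Real.exp_le_exp.2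
        nlinarith

lemma stuck_caseB2 (H : Hyp n P) {x : ℕ} (hx : Real.log n ≤ x) (hxn : 2 * (x : ℝ) < n)
    {a : ℝ} (hrho : a * x / 4 ≤ rho P x) (ha : 10 ^ 12 * Real.log n / n ≤ a) :
    (n.choose x : ℝ) * (1 - rho P x) ^ (n - x) ≤ Real.exp (-2 * Real.log n) := by
  have np := H.npos
  have hL := H.hL
  set L := Real.log n with hLd
  have hxn' : x < n := by
    have : (x : ℝ) < n := by linarith
    exact_mod_cast this
  have hcast : ((n - x : ℕ) : ℝ) = n - x := by push_cast [Nat.cast_sub hxn'.le]; ring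
  have r1 := rho_le_one H.hP x
  have hr : 10 ^ 12 * L / n * x / 4 ≤ rho P x := by
    refine le_trans ?_ hrho
    gcongr
  have hp := pow_le_exp_of (by linarith) hr (n - x) (z := n / 2) (by positivity)
    (by rw [hcast]; linarith)
  have hc := choose_le_exp (n := n) (x := x) (by omega)
  have e : 10 ^ 12 * L / n * x / 4 * (n / 2) = 10 ^ 12 * L * x / 8 := by field_simp; ring
  rw [e] at hp
  calc _ ≤ Real.exp (L * x) * Real.exp (-(10 ^ 12 * L * x / 8)) := by
        gcongr
    _ = Real.exp (L * x - 10 ^ 12 * L * x / 8) := by rw [← Real.exp_add]; ring_nf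
    _ ≤ _ := by
        apply Real.exp_le_exp.2
        nlinarith

lemma stuck_caseB3 (H : Hyp n P) {x : ℕ} (hx : Real.log n ≤ x) (hxn : 2 * (x : ℝ) < n)
    (hrho : 1 / 4 ≤ rho P x) :
    (n.choose x : ℝ) * (1 - rho P x) ^ (n - x) ≤ Real.exp (-2 * Real.log n) := by
  have np := H.npos
  have hL := H.hL
  have hn := H.hn
  set L := Real.log n with hLd
  have hxn' : x < n := by
    have : (x : ℝ) < n := by linarith
    exact_mod_cast this
  have hcast : ((n - x : ℕ) : ℝ) = n - x := by push_cast [Nat.cast_sub hxn'.le]; ring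
  have r1 := rho_le_one H.hP x
  have hLn : 32 * L ≤ n := by nlinarith [mul_self_nonneg L, mul_self_nonneg (L - 1)]
  by_cases h : 16 * L * x ≤ n
  · have hp := pow_le_exp_of (by linarith) hrho (n - x) (z := n / 2) (by positivity)
      (by rw [hcast]; linarith)
    have hc := choose_le_exp (n := n) (x := x) (by omega)
    calc _ ≤ Real.exp (L * x) * Real.exp (-(1 / 4 * (n / 2))) := by
          gcongr
      _ = Real.exp (L * x - (1 / 4 * (n / 2))) := by rw [← Real.exp_add]; ring_nf
      _ ≤ _ := by
          apply Real.exp_le_exp.2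
          nlinarith
  · push Not at h
    have hu : ∀ b, 9 ≤ P b * x := by
      intro b
      calc (9 : ℝ) ≤ 10 ^ 12 * L / n * x := by
            rw [div_mul_eq_mul_div, le_div_iff₀ np]; linarith
        _ ≤ _ := by
            have := H.hlow b
            gcongr
    have h1 : 1 - rho P x ≤ Real.exp (-8) := by
      refine (one_sub_rho_le H.hP x).trans ?_
      have e : ∀ b, Real.exp (-(P b * x)) ≤ Real.exp (-8) / 2 := by
        intro b
        have : Real.exp (-(P b * x)) ≤ Real.exp (-8 + -1) :=
          Real.exp_le_exp.2 (by linarith [hu b])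
        rw [Real.exp_add] at this
        have h2 : Real.exp (-1) ≤ 1 / 2 := by
          have := one_sub_exp_ge (show (0:ℝ) ≤ 1 by norm_num)
          linarith
        have : Real.exp (-8) * Real.exp (-1) ≤ Real.exp (-8) * (1 / 2) := by gcongr
        linarith
      linarith [e true, e false]
    have hc : (n.choose x : ℝ) ≤ Real.exp n := by
      have h2 : (n.choose x : ℝ) ≤ (2 : ℝ) ^ n := by exact_mod_cast Nat.choose_le_two_pow n x
      refine h2.trans ?_
      rw [← Real.exp_one_pow]
      gcongr
      linarith [Real.exp_one_gt_d9]
    calc _ ≤ Real.exp n * (Real.exp (-8)) ^ (n - x) := by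
          have : 0 ≤ 1 - rho P x := by linarith
          gcongr
      _ = Real.exp (n - 8 * (n - x)) := by
          rw [← Real.exp_nat_mul, ← Real.exp_add, hcast]; ring_nf
      _ ≤ _ := by
          apply Real.exp_le_exp.2
          nlinarith

lemma stuck_term (H : Hyp n P) {x : ℕ} (hx : Real.log n ≤ x) (hxn : x < n) {s : ℝ}
    (hs1 : s ≤ 1)
    (hs : s ≤ ((x : ℝ) ^ (x - 1)) ^ 2 * (P true * P false) ^ (x - 1)) :
    (n.choose x : ℝ) * (s * (1 - rho P x) ^ (n - x)) ≤ Real.exp (-2 * Real.log n) := by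
  have r1 := rho_le_one H.hP x
  have hpw : 0 ≤ (1 - rho P x) ^ (n - x) := pow_nonneg (by linarith) _
  have red : (n.choose x : ℝ) * (s * (1 - rho P x) ^ (n - x)) ≤
      (n.choose x : ℝ) * (1 - rho P x) ^ (n - x) := by
    have := mul_le_mul_of_nonneg_right hs1 hpw
    rw [one_mul] at this
    gcongr
  by_cases hA : (n : ℝ) ≤ 2 * x
  · exact red.trans (stuck_caseA H hxn hA)
  push Not at hA
  have hx0 : (0 : ℝ) ≤ x := by positivity
  rcases le_total (P true * x) 1 with h1 | h1 <;> rcases le_total (P false * x) 1 with h2 | h2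
  · refine le_trans ?_ (stuck_caseB1 H hx hA h1 h2)
    rw [mul_assoc]
    gcongr
  · refine red.trans (stuck_caseB2 H hx hA (a := P true) ?_ (H.hlow _))
    have a1 := half_of_le (H.hP true).1 (H.hP true).2 x h1
    have a2 := half_of_ge (H.hP false).2 x h2
    unfold rho
    have := mul_nonneg (H.hP true).1 hx0
    nlinarith
  · refine red.trans (stuck_caseB2 H hx hA (a := P false) ?_ (H.hlow _))
    have a1 := half_of_le (H.hP false).1 (H.hP false).2 x h2
    have a2 := half_of_ge (H.hP true).2 x h1
    unfold rho
    have := mul_nonneg (H.hP false).1 hx0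
    nlinarith
  · refine red.trans (stuck_caseB3 H hx hA ?_)
    have a1 := half_of_ge (H.hP false).2 x h2
    have a2 := half_of_ge (H.hP true).2 x h1
    unfold rho
    nlinarith

lemma stuck_main (H : Hyp n P) (m : ℕ) (hm : Real.log n ≤ m) :
    pr n P (fun ω => ∃ X : Finset (Fin n), (m ≤ X.card ∧ X ≠ Finset.univ) ∧
      Spanned ω X ∧ ∀ w ∈ Xᶜ, ¬ joined ω X w) ≤ Real.exp (-Real.log n) := by
  have np := H.npos
  have h1 : pr n P (fun ω => ∃ X : Finset (Fin n), (m ≤ X.card ∧ X ≠ Finset.univ) ∧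
      Spanned ω X ∧ ∀ w ∈ Xᶜ, ¬ joined ω X w) ≤
      pr n P (fun ω => ∃ x ∈ Finset.Ico m n, ∃ X ∈ (Finset.univ : Finset (Fin n)).powersetCard x,
        Spanned ω X ∧ ∀ w ∈ Xᶜ, ¬ joined ω X w) := by
    apply pr_mono
    rintro ω ⟨X, ⟨hX, hne⟩, h⟩
    refine ⟨X.card, Finset.mem_Ico.2 ⟨hX, ?_⟩, X, by simp, h⟩
    have := Finset.card_lt_card (Finset.ssubset_univ_iff.2 hne)
    simpa using this
  refine h1.trans ((pr_ex _ _).trans ?_)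
  have h2 : ∀ x ∈ Finset.Ico m n, pr n P (fun ω =>
      ∃ X ∈ (Finset.univ : Finset (Fin n)).powersetCard x,
        Spanned ω X ∧ ∀ w ∈ Xᶜ, ¬ joined ω X w) ≤ Real.exp (-2 * Real.log n) := by
    intro x hx
    rw [Finset.mem_Ico] at hx
    refine (pr_ex _ _).trans ?_
    have h3 : ∀ X ∈ (Finset.univ : Finset (Fin n)).powersetCard x,
        pr n P (fun ω => Spanned ω X ∧ ∀ w ∈ Xᶜ, ¬ joined ω X w) ≤
        min 1 (((x : ℝ) ^ (x - 1)) ^ 2 * (P true * P false) ^ (x - 1)) *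
          (1 - rho P x) ^ (n - x) := by
      intro X hX
      rw [Finset.mem_powersetCard_univ] at hX
      rw [stuck_eq H.hP X Xᶜ disjoint_compl_right, Finset.card_compl, Fintype.card_fin, hX]
      have r1 := rho_le_one H.hP x
      have hpw : 0 ≤ (1 - rho P x) ^ (n - x) := pow_nonneg (by linarith) _
      apply mul_le_mul_of_nonneg_right _ hpw
      refine le_min (pr_le_one _) ?_
      have := spanned_bound H.hP X
      rwa [hX] at this
    refine (Finset.sum_le_sum h3).trans ?_
    rw [Finset.sum_const, Finset.card_powersetCard, Finset.card_univ, Fintype.card_fin,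
      nsmul_eq_mul]
    refine stuck_term H ?_ hx.2 (min_le_left _ _) (min_le_right _ _)
    exact hm.trans (by exact_mod_cast hx.1)
  refine (Finset.sum_le_sum h2).trans ?_
  rw [Finset.sum_const, Nat.card_Ico, nsmul_eq_mul]
  calc ((n - m : ℕ) : ℝ) * Real.exp (-2 * Real.log n)
      ≤ Real.exp (Real.log n) * Real.exp (-2 * Real.log n) := by
        rw [Real.exp_log np]
        gcongr
        omega
    _ = _ := by rw [← Real.exp_add]; ring_nf

end Jig

namespace Jig

variable {n : ℕ} {P : Bool → ℝ}

lemma sum_inv_sqrt' (k : ℕ) :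
    ∑ j ∈ Finset.Ico 1 (k + 1), 1 / Real.sqrt j ≤ 2 * Real.sqrt k := by
  induction k with
  | zero => simp
  | succ k ih =>
    rw [Finset.sum_Ico_succ_top (by omega)]
    have hk : (0 : ℝ) ≤ k := by positivity
    have hk' : (0 : ℝ) < ((k + 1 : ℕ) : ℝ) := by positivity
    have s1 := Real.sq_sqrt hk
    have s2 := Real.sq_sqrt hk'.le
    have p1 := Real.sqrt_nonneg (k : ℝ)
    have p2 := Real.sqrt_pos.2 hk'
    set a := Real.sqrt (k : ℝ)
    set b := Real.sqrt ((k + 1 : ℕ) : ℝ)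
    have h : 1 / b ≤ 2 * b - 2 * a := by
      rw [div_le_iff₀ p2]
      push_cast at s2
      nlinarith [sq_nonneg (a - b)]
    linarith

lemma sum_inv_sqrt (m : ℕ) : ∑ j ∈ Finset.Ico 1 m, 1 / Real.sqrt j ≤ 2 * Real.sqrt m := by
  rcases m with _ | k
  · simp
  refine (sum_inv_sqrt' k).trans ?_
  gcongr
  omega

lemma Hyp.upper (H : Hyp n P) (b : Bool) : P b * Real.log n ^ 2 ≤ 1 := by
  have np := H.npos
  have hL := H.hL
  have hl := H.hlow (!b)
  have hp := H.hprod
  set L := Real.log n with hLd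
  have e : P b * P (!b) = 10 ^ 12 / (n * L) := by
    cases b
    · simpa [mul_comm] using hp
    · simpa using hp
  have h1 : P b * (10 ^ 12 * L / n) ≤ 10 ^ 12 / (n * L) := by
    rw [← e]
    exact mul_le_mul_of_nonneg_left hl (H.hP b).1
  have e2 : P b * L ^ 2 = P b * (10 ^ 12 * L / n) * (n * L / 10 ^ 12) := by
    field_simp
  have e3 : (1 : ℝ) = 10 ^ 12 / (n * L) * (n * L / 10 ^ 12) := by
    field_simp
  rw [e2, e3]
  exact mul_le_mul_of_nonneg_right h1 (by positivity)

lemma q_bound {y : ℝ} (hy : 0 < y) : Real.exp (-(4 * y)) ≤ 1 - Real.exp (-(1 / y ^ 4)) := by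
  refine le_trans ?_ (one_sub_exp_ge (by positivity))
  have e : (1 / y ^ 4) / (1 + 1 / y ^ 4) = 1 / (1 + y ^ 4) := by field_simp; ring
  rw [e, Real.exp_neg, ← one_div]
  apply one_div_le_one_div_of_le (by positivity)
  have h1 : Real.exp (4 * y) = Real.exp y ^ 4 := by rw [← Real.exp_nat_mul]; norm_num
  rw [h1]
  calc 1 + y ^ 4 ≤ (y + 1) ^ 4 := by nlinarith [pow_pos hy 2, pow_pos hy 3]
    _ ≤ _ := by gcongr; exact Real.add_one_le_exp y

lemma seed_final (H : Hyp n P) :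
    pr n P (fun ω => ¬ ∃ S : Finset (Fin n), ⌈Real.log n⌉₊ ≤ S.card ∧ Span ω S) ≤
      Real.exp (-Real.exp (Real.log n / 4)) := by
  have np := H.npos
  have hL := H.hL
  have hn := H.hn
  have hup := H.upper
  have hprod := H.hprod
  have hPb := H.hP
  set L := Real.log n with hLd
  set m := ⌈L⌉₊ with hm
  set s := Real.sqrt n with hs
  have hs2 : s ^ 2 = n := Real.sq_sqrt np.le
  have hs0 : 0 ≤ s := Real.sqrt_nonneg _
  have hm1 : (m : ℝ) < L + 1 := Nat.ceil_lt_add_one (by linarith)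
  have hM1 := Nat.ceil_lt_add_one (show 0 ≤ (n : ℝ) / (4 * L) by positivity)
  have hM2 := Nat.le_ceil ((n : ℝ) / (4 * L))
  have ht1 := Nat.ceil_lt_add_one hs0
  have ht2 := Nat.le_ceil s
  have hmpos : 1 ≤ m := Nat.one_le_iff_ne_zero.2 (by
    intro h0
    have := Nat.le_ceil L
    rw [← hm, h0] at this
    norm_num at this
    linarith)
  set M := ⌈(n : ℝ) / (4 * L)⌉₊ with hM
  set t := ⌈s⌉₊ with ht
  have hLs : 10 ^ 6 * L ≤ s := by
    apply Real.le_sqrt_of_sq_le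
    nlinarith [mul_self_nonneg L]
  have hsize : m * (M + t) ≤ n := by
    have : (m : ℝ) * (M + t) ≤ n := by
      calc (m : ℝ) * (M + t) ≤ (3 / 2 * L) * (n / (4 * L) + 1 + (s + 1)) := by
            apply mul_le_mul <;> first | positivity | linarith
        _ = 3 / 8 * n + 3 / 2 * L * (s + 2) := by field_simp; ring
        _ ≤ n := by nlinarith
    exact_mod_cast this
  set y : ℕ → ℝ := fun j => Real.sqrt L / 500 * (1 / Real.sqrt j) with hy
  have hy0 : ∀ j, 0 ≤ y j := fun j => by positivity
  have key := seed_main hPb m hmpos M t (fun j => Real.exp (-(4 * y j)))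
    (fun j => (Real.exp_pos _).le)
    (fun j => Real.exp_le_one_iff.2 (by linarith [hy0 j])) (by
      intro j h1 h2
      have hjL : (j : ℝ) < L := Nat.lt_ceil.1 h2
      have hj0 : (0 : ℝ) < j := by exact_mod_cast h1
      have hu : ∀ b, P b * j ≤ 1 := by
        intro b
        refine le_trans ?_ (hup b)
        have := (hPb b).1
        gcongr
        nlinarith
      have hr : 10 ^ 12 * (j : ℝ) ^ 2 / (4 * (n * L)) ≤ rho P j := by
        have a1 := half_of_le (H.hP true).1 (H.hP true).2 j (hu true)
        have a2 := half_of_le (H.hP false).1 (H.hP false).2 j (hu false)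
        have b1 := (H.hP true).1
        have b2 := (H.hP false).1
        unfold rho
        calc 10 ^ 12 * (j : ℝ) ^ 2 / (4 * (n * L)) = (10 ^ 12 / (n * L)) * j ^ 2 / 4 := by
              field_simp
          _ = (P true * j / 2) * (P false * j / 2) := by rw [← hprod]; ring
          _ ≤ _ := by
              apply mul_le_mul a1 a2 (by positivity)
              refine le_trans ?_ a1
              positivity
      have r1 := rho_le_one hPb j
      have hp := pow_le_exp_of (by linarith) hr M (z := n / (4 * L)) (by positivity) hM2
      have yp : 0 < y j := by
        have := Real.sqrt_pos.2 hj0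
        have := Real.sqrt_pos.2 (show 0 < L by linarith)
        simp only [hy]; positivity
      have y4 : y j ^ 4 = L ^ 2 / 500 ^ 4 / j ^ 2 := by
        have e1 : Real.sqrt L ^ 4 = L ^ 2 := by
          rw [show (4 : ℕ) = 2 * 2 by norm_num, pow_mul, Real.sq_sqrt (by linarith)]
        have e2 : Real.sqrt j ^ 4 = (j : ℝ) ^ 2 := by
          rw [show (4 : ℕ) = 2 * 2 by norm_num, pow_mul, Real.sq_sqrt (by linarith)]
        simp only [hy]
        rw [mul_pow, div_pow, div_pow, e1, e2]; ring
      have e : 10 ^ 12 * (j : ℝ) ^ 2 / (4 * (n * L)) * (n / (4 * L)) = 1 / y j ^ 4 := by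
        rw [y4]; field_simp; norm_num
      rw [e] at hp
      have := q_bound yp
      linarith) hsize
  refine key.trans ?_
  have hQ : Real.exp (-(L / 4)) ≤ ∏ j ∈ Finset.Ico 1 m, Real.exp (-(4 * y j)) := by
    rw [← Real.exp_sum]
    apply Real.exp_le_exp.2
    rw [Finset.sum_neg_distrib, neg_le_neg_iff, ← Finset.mul_sum, ← Finset.mul_sum]
    have h1 := sum_inv_sqrt m
    have h2 : Real.sqrt m ≤ 2 * Real.sqrt L := by
      rw [show (2 : ℝ) = Real.sqrt 4 by
        rw [show (4 : ℝ) = 2 ^ 2 by norm_num]; simp, ← Real.sqrt_mul (by norm_num)]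
      apply Real.sqrt_le_sqrt
      linarith
    have h3 := Real.mul_self_sqrt (show 0 ≤ L by linarith)
    have h4 := Real.sqrt_nonneg L
    nlinarith [mul_le_mul_of_nonneg_left (h1.trans (mul_le_mul_of_nonneg_left h2 zero_le_two)) h4]
  have hQ1 : ∏ j ∈ Finset.Ico 1 m, Real.exp (-(4 * y j)) ≤ 1 :=
    Finset.prod_le_one (fun j _ => (Real.exp_pos _).le)
      (fun j _ => Real.exp_le_one_iff.2 (by linarith [hy0 j]))
  refine (pow_le_exp_of (by linarith) hQ t (Real.exp_pos _).le ht2).trans ?_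
  apply Real.exp_le_exp.2
  have hse : s = Real.exp (L / 2) := by
    rw [hs, Real.sqrt_eq_iff_mul_self_eq np.le (Real.exp_pos _).le, ← Real.exp_add, hLd]
    rw [add_halves, Real.exp_log np]
  rw [hse, ← Real.exp_add, neg_le_neg_iff]
  apply Real.exp_le_exp.2
  linarith

end Jig

namespace Jig

variable {n : ℕ} {P : Bool → ℝ}

lemma part1_bound (hP : ∀ b, 0 ≤ P b ∧ P b ≤ 1) (hL : 2 ≤ Real.log n)
    (hn : 10 ^ 12 * Real.log n ^ 3 ≤ n)
    (hprod : P true * P false ≤ 1 / (10 ^ 12 * n * Real.log n)) :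
    pr n P (fun ω => JPercolates 1 (edges true ω) (edges false ω)) ≤
      Real.exp (5 - 2 * Real.log n) := by
  have np : (0 : ℝ) < n := by
    have : 0 < Real.log n ^ 3 := by positivity
    linarith
  set L := Real.log n with hLd
  set k := ⌈L⌉₊ with hk
  have hk1 : (k : ℝ) < L + 1 := Nat.ceil_lt_add_one (by linarith)
  have hk2 : L ≤ k := Nat.le_ceil L
  have k2 : 2 ≤ k := by
    have : (2 : ℝ) ≤ k := by linarith
    exact_mod_cast this
  have hkn : k + 1 ≤ n := by
    have : ((k + 1 : ℕ) : ℝ) ≤ n := by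
      push_cast
      nlinarith [mul_self_nonneg L, mul_self_nonneg (L - 1)]
    exact_mod_cast this
  have q0 := mul_nonneg (hP true).1 (hP false).1
  have h1 : pr n P (fun ω => JPercolates 1 (edges true ω) (edges false ω)) ≤
      pr n P (fun ω => ∃ x ∈ Finset.Icc k (2 * k),
        ∃ X ∈ (Finset.univ : Finset (Fin n)).powersetCard x, Spanned ω X) := by
    apply pr_mono
    intro ω h
    obtain ⟨S, a, b, hS⟩ := exists_spanned h k2 (by omega)
    exact ⟨S.card, Finset.mem_Icc.2 ⟨a, b⟩, S, by simp, hS⟩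
  refine h1.trans ((pr_ex _ _).trans ?_)
  have h2 : ∀ x ∈ Finset.Icc k (2 * k), pr n P (fun ω =>
      ∃ X ∈ (Finset.univ : Finset (Fin n)).powersetCard x, Spanned ω X) ≤
      Real.exp (5 - 3 * L) := by
    intro x hx
    rw [Finset.mem_Icc] at hx
    refine (pr_ex _ _).trans ?_
    have h3 : ∀ X ∈ (Finset.univ : Finset (Fin n)).powersetCard x,
        pr n P (fun ω => Spanned ω X) ≤
        (((x : ℝ) ^ (x - 1)) ^ 2 * (P true * P false) ^ (x - 1)) := by
      intro X hX
      rw [Finset.mem_powersetCard_univ] at hX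
      have := spanned_bound hP X
      rwa [hX] at this
    refine (Finset.sum_le_sum h3).trans ?_
    rw [Finset.sum_const, Finset.card_powersetCard, Finset.card_univ, Fintype.card_fin,
      nsmul_eq_mul]
    refine (choose_bound n x (by omega) q0).trans ?_
    have hx1 : L ≤ x := hk2.trans (by exact_mod_cast hx.1)
    have hx2 : (x : ℝ) ≤ 3 * L := by
      have : (x : ℝ) ≤ 2 * k := by exact_mod_cast hx.2
      nlinarith
    have he : Real.exp 1 * n * x * (P true * P false) ≤ Real.exp (-4) := by
      have h4 : Real.exp (-4) ≥ 1 / 81 := by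
        rw [Real.exp_neg, ← one_div, ge_iff_le]
        apply one_div_le_one_div_of_le (Real.exp_pos _)
        have : Real.exp 4 = Real.exp 1 ^ 4 := by rw [← Real.exp_nat_mul]; norm_num
        rw [this]
        calc Real.exp 1 ^ 4 ≤ 3 ^ 4 := by gcongr; linarith [Real.exp_one_lt_d9]
          _ = 81 := by norm_num
      calc Real.exp 1 * n * x * (P true * P false)
          ≤ 3 * n * (3 * L) * (1 / (10 ^ 12 * n * L)) := by
            have := Real.exp_one_lt_d9
            gcongr
            linarith
        _ = 9 / 10 ^ 12 := by field_simp; norm_num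
        _ ≤ _ := by linarith
    calc n * Real.exp 1 * (Real.exp 1 * n * x * (P true * P false)) ^ (x - 1)
        ≤ Real.exp L * Real.exp 1 * (Real.exp (-4)) ^ (x - 1) := by
          rw [hLd, Real.exp_log np]
          gcongr
      _ = Real.exp (L + 1 + (x - 1 : ℕ) * (-4)) := by
          rw [← Real.exp_nat_mul, ← Real.exp_add, ← Real.exp_add]
      _ ≤ _ := by
          apply Real.exp_le_exp.2
          rw [Nat.cast_sub (by omega)]
          push_cast
          linarith
  refine (Finset.sum_le_sum h2).trans ?_
  rw [Finset.sum_const, Nat.card_Icc, nsmul_eq_mul]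
  calc ((2 * k + 1 - k : ℕ) : ℝ) * Real.exp (5 - 3 * L)
      ≤ Real.exp L * Real.exp (5 - 3 * L) := by
        rw [hLd, Real.exp_log np]
        gcongr
        omega
    _ = _ := by rw [← Real.exp_add]; ring_nf

lemma jperc_mono {ω ω' : Om n} (h : ∀ i, ω i = true → ω' i = true)
    (hp : JPercolates 1 (edges true ω) (edges false ω)) :
    JPercolates 1 (edges true ω') (edges false ω') := by
  have he : ∀ b, edges b ω ⊆ edges b ω' := by
    intro b e
    simp only [edges, Finset.mem_filter]
    exact fun hh => ⟨hh.1, h _ hh.2⟩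
  unfold JPercolates PercolatesOn at hp ⊢
  refine Relation.ReflTransGen.mono ?_ _ _ hp
  rintro Q Q' ⟨C, hC, C', hC', hne, ⟨⟨a, ha, b, hb, e, hE, hs⟩, ⟨a', ha', b', hb', e', hE', hs'⟩⟩, hQ⟩
  exact ⟨C, hC, C', hC', hne, ⟨⟨a, ha, b, hb, e, he _ hE, hs⟩,
    ⟨a', ha', b', hb', e', he _ hE', hs'⟩⟩, hQ⟩

lemma thin {a τ p1 p2 : ℝ} (h1 : a ≤ p1) (h2 : a ≤ p2) (ha : a * a ≤ τ)
    (hτ : τ ≤ p1 * p2) :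
    ∃ r1 r2, a ≤ r1 ∧ r1 ≤ p1 ∧ a ≤ r2 ∧ r2 ≤ p2 ∧ r1 * r2 = τ := by
  have hc : ContinuousOn (fun t : ℝ => (a + t * (p1 - a)) * (a + t * (p2 - a)))
      (Set.Icc 0 1) := by fun_prop
  have := intermediate_value_Icc (zero_le_one (α := ℝ)) hc
  obtain ⟨t, ⟨t0, t1⟩, ht⟩ := this (show τ ∈ Set.Icc _ _ by
    constructor
    · simpa using ha
    · simpa using hτ)
  exact ⟨a + t * (p1 - a), a + t * (p2 - a), by nlinarith, by nlinarith, by nlinarith,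
    by nlinarith, ht⟩

lemma part2_hyp (H : Hyp n P) :
    1 - (Real.exp (-Real.exp (Real.log n / 4)) + Real.exp (-Real.log n)) ≤
    pr n P (fun ω => JPercolates 1 (edges true ω) (edges false ω)) := by
  have h1 := seed_final H
  have h2 := stuck_main H ⌈Real.log n⌉₊ (Nat.le_ceil _)
  have h3 := pr_not (n := n) (P := P) (fun ω => JPercolates 1 (edges true ω) (edges false ω))
  have h4 : pr n P (fun ω => ¬ JPercolates 1 (edges true ω) (edges false ω)) ≤
      Real.exp (-Real.exp (Real.log n / 4)) + Real.exp (-Real.log n) := by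
    refine le_trans ?_ (add_le_add h1 h2)
    refine le_trans (pr_mono ?_) (pr_or _ _)
    intro ω h
    by_contra hcon
    rw [not_or, not_not] at hcon
    exact h (perc_of_seed hcon.1 hcon.2)
  linarith

lemma part2_bound (hP : ∀ b, 0 ≤ P b ∧ P b ≤ 1) (hL : 2 ≤ Real.log n)
    (hn : 10 ^ 12 * Real.log n ^ 3 ≤ n)
    (hprod : 10 ^ 12 / (n * Real.log n) ≤ P true * P false)
    (hlow : ∀ b, 10 ^ 12 * Real.log n / n ≤ P b) :
    1 - (Real.exp (-Real.exp (Real.log n / 4)) + Real.exp (-Real.log n)) ≤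
    pr n P (fun ω => JPercolates 1 (edges true ω) (edges false ω)) := by
  have np : (0 : ℝ) < n := by
    have : 0 < Real.log n ^ 3 := by positivity
    linarith
  have a0 : 0 ≤ 10 ^ 12 * Real.log n / n := by positivity
  obtain ⟨r1, r2, c1, d1, c2, d2, e⟩ := thin (hlow true) (hlow false) (by
    rw [div_mul_div_comm, div_le_div_iff₀ (by positivity) (by positivity)]
    have := mul_le_mul_of_nonneg_left hn (show 0 ≤ 10 ^ 12 * (n : ℝ) by positivity)
    nlinarith) hprod
  have H : Hyp n (Pp r1 r2) :=
    { hP := by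
        intro b
        cases b
        · simp only [Pp]; exact ⟨a0.trans c2, d2.trans (hP false).2⟩
        · simp only [Pp]; exact ⟨a0.trans c1, d1.trans (hP true).2⟩
      hL := hL
      hn := hn
      hlow := by intro b; cases b <;> simpa [Pp]
      hprod := by simpa [Pp] using e }
  refine (part2_hyp H).trans (pr_mono_p ?_ fun ω ω' h => jperc_mono h)
  intro b; cases b <;> simpa [Pp]

lemma ev_log : ∀ᶠ n : ℕ in atTop, 2 ≤ Real.log n ∧ 10 ^ 12 * Real.log n ^ 3 ≤ n := by
  have h1 : ∀ᶠ x : ℝ in atTop, 2 ≤ Real.log x := Real.tendsto_log_atTop.eventually_ge_atTop 2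
  have h2 := (Real.isLittleO_pow_log_id_atTop (n := 3)).bound
    (show (0 : ℝ) < 1 / 10 ^ 12 by positivity)
  have h3 := (h1.and h2).and (eventually_ge_atTop 0)
  refine (tendsto_natCast_atTop_atTop.eventually h3).mono ?_
  rintro n ⟨⟨a, b⟩, c⟩
  refine ⟨a, ?_⟩
  have : 0 ≤ Real.log n ^ 3 := by positivity
  rw [Real.norm_of_nonneg this, id, Real.norm_of_nonneg c] at b
  linarith

lemma tlog : Tendsto (fun n : ℕ => Real.log n) atTop atTop :=
  Real.tendsto_log_atTop.comp tendsto_natCast_atTop_atTop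

end Jig

/-- **Theorem (Bollobás–Riordan–Slivken–Smith).** Jigsaw percolation on a pair of independent
binomial random graphs `G1 ~ G(n,p1)`, `G2 ~ G(n,p2)` (the case `k = 2`, `j = 1` of the
double hypergraph model: vertices are elements of `[n]`, clusters merge when joined by a red
and a blue edge).  There is a constant `c > 0` such that:
(1) if `p1·p2 ≤ 1/(c·n·log n)` then whp `(G1,G2)` does not percolate;
(2) if `p1·p2 ≥ c/(n·log n)` and `min{p1,p2} ≥ c·log n/n` then whp `(G1,G2)` percolates. -/
theorem jigsaw_graph_threshold :
    ∃ c : ℝ, 0 < c ∧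
      ∀ p1 p2 : ℕ → ℝ,
        (∀ n, 0 ≤ p1 n ∧ p1 n ≤ 1) →
        (∀ n, 0 ≤ p2 n ∧ p2 n ≤ 1) →
        ((∀ᶠ n : ℕ in atTop, p1 n * p2 n ≤ 1 / (c * (n : ℝ) * Real.log n)) →
          Tendsto
            (fun n : ℕ => probHk n 2 (p1 n) (p2 n) fun E1 E2 => ¬ JPercolates 1 E1 E2)
            atTop (nhds 1)) ∧
        ((∀ᶠ n : ℕ in atTop,
            c / ((n : ℝ) * Real.log n) ≤ p1 n * p2 n ∧
            c * Real.log n / (n : ℝ) ≤ min (p1 n) (p2 n)) →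
          Tendsto
            (fun n : ℕ => probHk n 2 (p1 n) (p2 n) fun E1 E2 => JPercolates 1 E1 E2)
            atTop (nhds 1)) := by
  refine ⟨10 ^ 12, by norm_num, fun p1 p2 hp1 hp2 => ?_⟩
  have hP : ∀ n b, 0 ≤ Jig.Pp (p1 n) (p2 n) b ∧ Jig.Pp (p1 n) (p2 n) b ≤ 1 := by
    intro n b
    cases b <;> simp [Jig.Pp, hp1 n, hp2 n]
  constructor
  · intro h
    have lim : Tendsto (fun n : ℕ => 1 - Real.exp (5 - 2 * Real.log n)) atTop (nhds 1) := by
      have h1 : Tendsto (fun n : ℕ => -(5 - 2 * Real.log n)) atTop atTop := by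
        have := tendsto_atTop_add_const_right atTop (-5 : ℝ)
          (Jig.tlog.const_mul_atTop (show (0 : ℝ) < 2 by norm_num))
        refine this.congr fun n => by ring
      have h2 := Real.tendsto_exp_neg_atTop_nhds_zero.comp h1
      have h3 := h2.const_sub 1
      simpa [Function.comp_def] using h3
    refine tendsto_of_tendsto_of_tendsto_of_le_of_le' lim tendsto_const_nhds ?_ ?_
    · filter_upwards [h, Jig.ev_log] with n hn hl
      rw [Jig.transfer n (hp1 n) (hp2 n)]
      have e := Jig.pr_not (n := n) (P := Jig.Pp (p1 n) (p2 n))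
        (fun ω => JPercolates 1 (Jig.edges true ω) (Jig.edges false ω))
      rw [e]
      have := Jig.part1_bound (hP n) hl.1 hl.2 (by simpa [Jig.Pp] using hn)
      linarith
    · filter_upwards with n
      rw [Jig.transfer n (hp1 n) (hp2 n)]
      exact Jig.pr_le_one _
  · intro h
    have lim : Tendsto (fun n : ℕ => 1 - (Real.exp (-Real.exp (Real.log n / 4)) +
        Real.exp (-Real.log n))) atTop (nhds 1) := by
      have h1 : Tendsto (fun n : ℕ => Real.exp (Real.log n / 4)) atTop atTop :=
        Real.tendsto_exp_atTop.comp (Jig.tlog.atTop_div_const (by norm_num))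
      have h2 := Real.tendsto_exp_neg_atTop_nhds_zero.comp h1
      have h3 := Real.tendsto_exp_neg_atTop_nhds_zero.comp Jig.tlog
      have h4 := (h2.add h3).const_sub 1
      simpa only [Function.comp_def, add_zero, sub_zero] using h4
    refine tendsto_of_tendsto_of_tendsto_of_le_of_le' lim tendsto_const_nhds ?_ ?_
    · filter_upwards [h, Jig.ev_log] with n hn hl
      rw [Jig.transfer n (hp1 n) (hp2 n)]
      refine Jig.part2_bound (hP n) hl.1 hl.2 (by simpa [Jig.Pp] using hn.1) ?_
      have := le_min_iff.1 hn.2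
      intro b
      cases b
      · simpa [Jig.Pp] using this.2
      · simpa [Jig.Pp] using this.1
    · filter_upwards with n
      rw [Jig.transfer n (hp1 n) (hp2 n)]
      exact Jig.pr_le_one _
end

section
/- Let 1 ≤ j ≤ k−1 be integers. There exists a constant C = C(k,j) > 0 such that for every finite set V and all integers ℓ, r, b with ℓ > r ≥ 0 and ℓ > b ≥ 0, the number of edge-minimal traversable triples on V of size ℓ with r red edges and b blue edges satisfies |T_{ℓ,r,b}| ≤ |V|^j · C^{ℓ−1} · (|V|^{k−j})^r · (ℓ·|V|^{k−j−1})^b. -/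
open Finset Filter

/-- A subfamily `Jstar ⊆ Jfam` of `j`-sets is `Jfam`-traversable in the `k`-graph `(V, E)`:
for any two distinct `A, B ∈ Jstar` there is a sequence of edges `e_0, …, e_m ∈ E` with
`A ⊆ e_0`, `B ⊆ e_m`, such that the intersection of any two consecutive edges contains some
`j`-set belonging to `Jfam`.  (Singletons are trivially traversable.) -/
def TravIn {V : Type*} [DecidableEq V] (Jfam E Jstar : Finset (Finset V)) : Prop :=
  ∀ A ∈ Jstar, ∀ B ∈ Jstar, A ≠ B →
    ∃ (m : ℕ) (es : Fin (m + 1) → Finset V),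
      (∀ i, es i ∈ E) ∧ A ⊆ es 0 ∧ B ⊆ es (Fin.last m) ∧
      ∀ i : Fin m, ∃ I ∈ Jfam, I ⊆ es i.castSucc ∧ I ⊆ es i.succ

/-- The family `Jfam` is traversable in `(V, E)` if it is `Jfam`-traversable. -/
def Trav {V : Type*} [DecidableEq V] (Jfam E : Finset (Finset V)) : Prop :=
  TravIn Jfam E Jfam

/-- A triple `(J0, E1, E2)` is traversable if `J0` is traversable in both the red `k`-graph
`(V, E1)` and the blue `k`-graph `(V, E2)`. -/
def TravTriple {V : Type*} [DecidableEq V] (J0 E1 E2 : Finset (Finset V)) : Prop :=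
  Trav J0 E1 ∧ Trav J0 E2

/-- A triple `(J0, E1, E2)` is an edge-minimal traversable triple if it is traversable and
removing any edge from `E1` or from `E2` destroys traversability. -/
def EdgeMinTravTriple {V : Type*} [DecidableEq V] (J0 E1 E2 : Finset (Finset V)) : Prop :=
  TravTriple J0 E1 E2 ∧
  (∀ e ∈ E1, ¬ Trav J0 (E1.erase e)) ∧
  (∀ e ∈ E2, ¬ Trav J0 (E2.erase e))
/-- `T_{ℓ,r,b}`: the set of all edge-minimal traversable triples `(J0, E1, E2)` on the
finite vertex set `V` (with `J0 ⊆ V^{(j)}` and `E1, E2 ⊆ V^{(k)}`) of size `|J0| = ℓ` with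
`|E1| = r` red edges and `|E2| = b` blue edges. -/
def minTravTriples (k j : ℕ) (V : Type*) [DecidableEq V] [Fintype V] (ℓ r b : ℕ) :
    Set (Finset (Finset V) × Finset (Finset V) × Finset (Finset V)) :=
  {T | T.1 ⊆ (Finset.univ : Finset V).powersetCard j ∧
       T.2.1 ⊆ (Finset.univ : Finset V).powersetCard k ∧
       T.2.2 ⊆ (Finset.univ : Finset V).powersetCard k ∧
       EdgeMinTravTriple T.1 T.2.1 T.2.2 ∧
       T.1.card = ℓ ∧ T.2.1.card = r ∧ T.2.2.card = b}


namespace TravAux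

section perc
variable {X : Type*} [DecidableEq X] [Fintype X]

lemma sum_weight (p : X → ℝ) (R : Finset X) :
    ∑ U ∈ R.powerset, (∏ x ∈ U, p x) * ∏ x ∈ R \ U, (1 - p x) = 1 := by
  rw [← Finset.prod_add]
  simp

lemma animals (N : X → Finset X) (p : X → ℝ) (h0 : ∀ x, 0 ≤ p x) (h1 : ∀ x, p x ≤ 1)
    (v : X) (F : Finset (Finset X)) (hv : ∀ S ∈ F, v ∈ S)
    (hc : ∀ S ∈ F, ∀ U : Finset X, v ∈ U → (∀ x ∈ U, ∀ y ∈ S, y ∈ N x → y ∈ U) → S ⊆ U) :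
    ∑ S ∈ F, (∏ x ∈ S, p x) * ∏ x ∈ S.biUnion N \ S, (1 - p x) ≤ 1 := by
  classical
  set w : Finset X → ℝ := fun W => (∏ x ∈ W, p x) * ∏ x ∈ univ \ W, (1 - p x) with hw
  have hw0 : ∀ W, 0 ≤ w W := fun W =>
    mul_nonneg (prod_nonneg fun x _ => h0 x) (prod_nonneg fun x _ => sub_nonneg.2 (h1 x))
  set R : Finset X → Finset X := fun S => univ \ (S ∪ S.biUnion N) with hR
  set ev : Finset X → Finset (Finset X) := fun S => (R S).powerset.image (fun U => S ∪ U) with hev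
  have hprob : ∀ S, (∏ x ∈ S, p x) * ∏ x ∈ S.biUnion N \ S, (1 - p x) = ∑ W ∈ ev S, w W := by
    intro S
    have hdis : ∀ U ∈ (R S).powerset, Disjoint S U := by
      intro U hU
      rw [mem_powerset] at hU
      rw [Finset.disjoint_left]
      intro x hx hxU
      have := hU hxU
      simp [hR, hx] at this
    rw [hev, Finset.sum_image]
    · have : ∀ U ∈ (R S).powerset, w (S ∪ U) =
          ((∏ x ∈ S, p x) * ∏ x ∈ S.biUnion N \ S, (1 - p x)) *
            ((∏ x ∈ U, p x) * ∏ x ∈ R S \ U, (1 - p x)) := by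
        intro U hU
        have hd := hdis U hU
        rw [mem_powerset] at hU
        have e1 : univ \ (S ∪ U) = (S.biUnion N \ S) ∪ (R S \ U) := by
          ext x
          have := @hU x
          simp only [hR, Finset.mem_sdiff, mem_union, mem_univ, true_and] at this ⊢
          tauto
        have d1 : Disjoint (S.biUnion N \ S) (R S \ U) := by
          rw [Finset.disjoint_left]
          intro x
          simp only [hR, Finset.mem_sdiff, mem_union, mem_univ, true_and]
          tauto
        simp only [hw]
        rw [e1, prod_union hd, prod_union d1]
        ring
      rw [Finset.sum_congr rfl this, ← Finset.mul_sum, sum_weight, mul_one]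
    · intro U hU U' hU' h
      have a := hdis U hU
      have b := hdis U' hU'
      simp only at h
      rw [← Finset.union_sdiff_cancel_left a, h, Finset.union_sdiff_cancel_left b]
  have hmem : ∀ S W, W ∈ ev S → S ⊆ W ∧ ∀ y ∈ W, y ∈ S.biUnion N → y ∈ S := by
    intro S W h
    simp only [hev, mem_image, mem_powerset] at h
    obtain ⟨U, hU, rfl⟩ := h
    refine ⟨subset_union_left, fun y hy hy' => ?_⟩
    rcases mem_union.1 hy with h | h
    · exact h
    · have := hU h
      simp only [hR, Finset.mem_sdiff, mem_union, mem_univ, true_and] at this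
      tauto
  have hsub : ∀ S ∈ F, ∀ S' ∈ F, ∀ W, W ∈ ev S → W ∈ ev S' → S' ⊆ S := by
    intro S hS S' hS' W h h'
    refine hc S' hS' S (hv S hS) fun x hx y hy hxy => ?_
    exact (hmem S W h).2 y ((hmem S' W h').1 hy) (mem_biUnion.2 ⟨x, hx, hxy⟩)
  have hdisj : (F : Set (Finset X)).PairwiseDisjoint ev := by
    intro S hS S' hS' hne
    change Disjoint (ev S) (ev S')
    rw [Finset.disjoint_left]
    intro W h h'
    exact hne (Subset.antisymm (hsub S' hS' S hS W h' h) (hsub S hS S' hS' W h h'))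
  rw [Finset.sum_congr rfl (fun S _ => hprob S), ← Finset.sum_biUnion hdisj]
  calc _ ≤ ∑ W ∈ (univ : Finset X).powerset, w W :=
        Finset.sum_le_sum_of_subset_of_nonneg (fun W _ => by simp) (fun W _ _ => hw0 W)
    _ = 1 := sum_weight p univ

lemma bdry (N : X → Finset X) (p : X → ℝ) (h0 : ∀ x, 0 ≤ p x) (h1 : ∀ x, p x ≤ 1)
    (S : Finset X) (h : ∀ x ∈ S, (1/2 : ℝ) ≤ ∏ y ∈ N x, (1 - p y)) :
    (1/2 : ℝ) ^ S.card ≤ ∏ x ∈ S.biUnion N, (1 - p x) := by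
  have nn : ∀ A : Finset X, 0 ≤ ∏ x ∈ A, (1 - p x) :=
    fun A => prod_nonneg fun x _ => sub_nonneg.2 (h1 x)
  have le1 : ∀ A : Finset X, ∏ x ∈ A, (1 - p x) ≤ 1 :=
    fun A => prod_le_one (fun x _ => sub_nonneg.2 (h1 x)) fun x _ => by linarith [h0 x]
  induction S using Finset.induction_on with
  | empty => simp
  | insert a S ha ih =>
    rw [card_insert_of_notMem ha, biUnion_insert, pow_succ']
    have i1 := ih fun x hx => h x (mem_insert_of_mem hx)
    have i2 := h a (mem_insert_self _ _)
    have := Finset.prod_union_inter (s₁ := N a) (s₂ := S.biUnion N) (f := fun x => 1 - p x)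
    calc (1/2 : ℝ) * (1/2) ^ S.card ≤ (∏ x ∈ N a, (1 - p x)) * ∏ x ∈ S.biUnion N, (1 - p x) :=
          mul_le_mul i2 i1 (by positivity) (nn _)
      _ = _ := this.symm
      _ ≤ _ := mul_le_of_le_one_right (nn _) (le1 _)

lemma bdry' (N : X → Finset X) (p : X → ℝ) (h0 : ∀ x, 0 ≤ p x) (h1 : ∀ x, p x ≤ 1)
    (S : Finset X) (h : ∀ x ∈ S, (1/2 : ℝ) ≤ ∏ y ∈ N x, (1 - p y)) :
    (1/2 : ℝ) ^ S.card ≤ ∏ x ∈ S.biUnion N \ S, (1 - p x) := by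
  refine (bdry N p h0 h1 S h).trans ?_
  have hi := Finset.prod_sdiff (f := fun x => 1 - p x)
    (Finset.inter_subset_left : S.biUnion N ∩ S ⊆ S.biUnion N)
  rw [Finset.sdiff_inter_self_left] at hi
  rw [← hi]
  exact mul_le_of_le_one_right (prod_nonneg fun x _ => sub_nonneg.2 (h1 x))
    (prod_le_one (fun x _ => sub_nonneg.2 (h1 x)) fun x _ => by linarith [h0 x])

end perc

section trav
variable {V : Type*} [DecidableEq V]

lemma trav_closed {J E : Finset (Finset V)} (ht : Trav J E) {A : Finset V} (hA : A ∈ J)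
    (P : Finset V → Prop) (Q : Finset V → Prop) (hP : P A)
    (h1 : ∀ I ∈ J, ∀ e ∈ E, I ⊆ e → P I → Q e)
    (h2 : ∀ I ∈ J, ∀ e ∈ E, I ⊆ e → Q e → P I) : ∀ B ∈ J, P B := by
  intro B hB
  by_cases hAB : A = B
  · exact hAB ▸ hP
  obtain ⟨m, es, hE, h0, hl, hs⟩ := ht A hA B hB hAB
  have : ∀ i, Q (es i) := by
    intro i
    induction i using Fin.induction with
    | zero => exact h1 A hA _ (hE _) h0 hP
    | succ i ih =>
      obtain ⟨I, hI, a, b⟩ := hs i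
      exact h1 I hI _ (hE _) b (h2 I hI _ (hE _) a ih)
  exact h2 B hB _ (hE _) hl (this _)

def Rch (J E : Finset (Finset V)) (A f : Finset V) : Prop :=
  ∃ (m : ℕ) (es : Fin (m + 1) → Finset V),
      (∀ i, es i ∈ E) ∧ A ⊆ es 0 ∧ es (Fin.last m) = f ∧
      ∀ i : Fin m, ∃ I ∈ J, I ⊆ es i.castSucc ∧ I ⊆ es i.succ

lemma Rch.base {J E : Finset (Finset V)} {A f : Finset V} (hf : f ∈ E) (h : A ⊆ f) :
    Rch J E A f := ⟨0, fun _ => f, fun _ => hf, h, rfl, fun i => i.elim0⟩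

lemma Rch.step {J E : Finset (Finset V)} {A f g I : Finset V} (h : Rch J E A f) (hg : g ∈ E)
    (hI : I ∈ J) (h1 : I ⊆ f) (h2 : I ⊆ g) : Rch J E A g := by
  obtain ⟨m, es, hE, h0, hl, hs⟩ := h
  refine ⟨m + 1, Fin.snoc (α := fun _ => Finset V) es g, ?_, ?_, ?_, ?_⟩
  · intro i
    refine Fin.lastCases ?_ (fun i => ?_) i
    · simpa using hg
    · simpa using hE i
  · have : (0 : Fin (m + 1 + 1)) = Fin.castSucc 0 := rfl
    rw [this, Fin.snoc_castSucc]
    exact h0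
  · simp
  · intro i
    refine Fin.lastCases ?_ (fun i => ?_) i
    · refine ⟨I, hI, ?_, ?_⟩
      · rw [Fin.snoc_castSucc, hl]; exact h1
      · rw [Fin.succ_last, Fin.snoc_last]; exact h2
    · rw [Fin.snoc_castSucc, Fin.succ_castSucc, Fin.snoc_castSucc]
      exact hs i

lemma two_of_min {J E : Finset (Finset V)} (ht : Trav J E) {e : Finset V}
    (hm : ¬ Trav J (E.erase e)) : ∃ A ∈ J, ∃ B ∈ J, A ≠ B ∧ A ⊆ e ∧ B ⊆ e := by
  by_contra hcon
  have huniq : ∀ A ∈ J, ∀ B ∈ J, A ⊆ e → B ⊆ e → A = B := by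
    intro A hA B hB h1 h2
    by_contra h
    exact hcon ⟨A, hA, B, hB, h, h1, h2⟩
  apply hm
  intro A hA B hB hAB
  have key : B = A ∨ ∃ f, Rch J (E.erase e) A f ∧ B ⊆ f := by
    refine trav_closed ht hA (fun I => I = A ∨ ∃ f, Rch J (E.erase e) A f ∧ I ⊆ f)
      (fun f => ∀ I ∈ J, I ⊆ f → (I = A ∨ ∃ f, Rch J (E.erase e) A f ∧ I ⊆ f)) (Or.inl rfl)
      ?_ ?_ B hB
    · intro I hI f hf hIf h K hK hKf
      by_cases hfe : f = e
      · subst hfe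
        rw [huniq K hK I hI hKf hIf]; exact h
      · have hf' : f ∈ E.erase e := mem_erase.2 ⟨hfe, hf⟩
        right
        rcases h with rfl | ⟨g, hg, hIg⟩
        · exact ⟨f, Rch.base hf' hIf, hKf⟩
        · exact ⟨f, hg.step hf' hI hIg hIf, hKf⟩
    · intro I hI f _ hIf h
      exact h I hI hIf
  rcases key with h | ⟨f, ⟨m, es, hE, h0, hl, hs⟩, hB⟩
  · exact absurd h.symm hAB
  · exact ⟨m, es, hE, h0, hl ▸ hB, hs⟩

end trav

section count
variable {V : Type*} [DecidableEq V] [Fintype V]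

def NN (k j : ℕ) : Finset V ⊕ Finset V → Finset (Finset V ⊕ Finset V)
  | Sum.inl A => ((univ.powersetCard k).filter (fun e => A ⊆ e)).map Function.Embedding.inr
  | Sum.inr e => (e.powersetCard j).map Function.Embedding.inl

lemma deg_up {k j : ℕ} {A : Finset V} (hA : A.card = j) :
    (((univ : Finset V).powersetCard k).filter (fun e => A ⊆ e)).card
      ≤ Fintype.card V ^ (k - j) := by
  have : (((univ : Finset V).powersetCard k).filter (fun e => A ⊆ e)).card ≤
      ((univ : Finset V).powersetCard (k - j)).card := by
    refine Finset.card_le_card_of_injOn (fun e => e \ A) ?_ ?_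
    · intro e he
      simp only [coe_filter, mem_powersetCard, Set.mem_ofPred_eq] at he
      simp only [mem_coe, mem_powersetCard, subset_univ, true_and]
      rw [card_sdiff_of_subset he.2, he.1.2, hA]
    · intro e he f hf h
      simp only [coe_filter, mem_powersetCard, Set.mem_ofPred_eq] at he hf
      simp only at h
      rw [← sdiff_union_of_subset he.2, h, sdiff_union_of_subset hf.2]
  refine this.trans ?_
  rw [card_powersetCard, card_univ]
  exact Nat.choose_le_pow _ _

lemma half_le {c : ℝ} {d : ℕ} (hc : 0 < c) (h : (d : ℝ) ≤ c) (h1 : 1 ≤ c) :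
    (1/2 : ℝ) ≤ (1 - 1 / (2 * c)) ^ d := by
  have h2 : 1 / (2 * c) ≤ 1 / 2 := by
    apply one_div_le_one_div_of_le <;> linarith
  have := one_add_mul_le_pow (a := - (1 / (2 * c))) (by linarith) d
  have h3 : (d : ℝ) * (1 / (2 * c)) ≤ 1 / 2 := by
    rw [mul_one_div, div_le_div_iff₀ (by positivity) (by norm_num)]
    linarith
  have e : 1 + - (1 / (2 * c)) = 1 - 1 / (2 * c) := by ring
  rw [e] at this
  linarith

lemma red_root (k j ℓ r : ℕ) (hn : 1 ≤ Fintype.card V) (A : Finset V)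
    (P : Finset (Finset (Finset V) × Finset (Finset V)))
    (hP : ∀ T ∈ P, A ∈ T.1 ∧ (∀ B ∈ T.1, B.card = j) ∧ (∀ e ∈ T.2, e.card = k) ∧
      Trav T.1 T.2 ∧ (∀ e ∈ T.2, ∃ B ∈ T.1, B ⊆ e) ∧ T.1.card = ℓ ∧ T.2.card = r) :
    (P.card : ℝ) ≤ (2 * 2 ^ k) ^ ℓ * (2 * (Fintype.card V : ℝ) ^ (k - j)) ^ r * 2 ^ (ℓ + r) := by
  classical
  have hn' : (1 : ℝ) ≤ Fintype.card V := by exact_mod_cast hn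
  set a : ℝ := (Fintype.card V : ℝ) ^ (k - j) with ha
  have ha1 : 1 ≤ a := one_le_pow₀ hn'
  have hc1 : (1 : ℝ) ≤ 2 ^ k := one_le_pow₀ (by norm_num)
  set p : Finset V ⊕ Finset V → ℝ := Sum.elim (fun _ => 1 / (2 * 2 ^ k)) (fun _ => 1 / (2 * a))
    with hp
  have h0 : ∀ x, 0 ≤ p x := by
    rintro (x | x) <;> simp only [hp, Sum.elim_inl, Sum.elim_inr] <;> positivity
  have h1 : ∀ x, p x ≤ 1 := by
    rintro (x | x) <;> simp only [hp, Sum.elim_inl, Sum.elim_inr] <;>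
      exact (div_le_one (by positivity)).2 (by linarith)
  set g : Finset (Finset V) × Finset (Finset V) → Finset (Finset V ⊕ Finset V) :=
    fun T => T.1.disjSum T.2 with hg
  have hgi : Function.Injective g := by
    rintro ⟨x, y⟩ ⟨x', y'⟩ h
    simp only [hg] at h
    have h1 : x = x' := by
      ext t
      have := congrArg (fun s => Sum.inl t ∈ s) h
      simpa using this
    have h2 : y = y' := by
      ext t
      have := congrArg (fun s => Sum.inr t ∈ s) h
      simpa using this
    rw [h1, h2]
  have main := animals (NN k j) p h0 h1 (Sum.inl A) (P.image g) (by
      intro S hS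
      obtain ⟨T, hT, rfl⟩ := mem_image.1 hS
      simpa [hg] using (hP T hT).1) (by
      intro S hS U hA hU
      obtain ⟨T, hT, rfl⟩ := mem_image.1 hS
      obtain ⟨hAT, hj, hk, ht, hx, -, -⟩ := hP T hT
      have q1 : ∀ I ∈ T.1, ∀ e ∈ T.2, I ⊆ e → Sum.inl I ∈ U → Sum.inr e ∈ U := by
        intro I hI e he hIe h
        refine hU _ h _ (by simpa [hg] using he) ?_
        simp [NN, hIe, hk e he]
      have q2 : ∀ I ∈ T.1, ∀ e ∈ T.2, I ⊆ e → Sum.inr e ∈ U → Sum.inl I ∈ U := by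
        intro I hI e he hIe h
        refine hU _ h _ (by simpa [hg] using hI) ?_
        simp [NN, hIe, hj I hI]
      have hall := trav_closed ht hAT (fun I => Sum.inl I ∈ U) (fun e => Sum.inr e ∈ U) hA q1 q2
      rintro (x | x) hx'
      · exact hall x (by simpa [hg] using hx')
      · have hx2 : x ∈ T.2 := by simpa [hg] using hx'
        obtain ⟨B, hB, hBe⟩ := hx x hx2
        exact q1 B hB x hx2 hBe (hall B hB))
  rw [Finset.sum_image (fun x _ y _ h => hgi h)] at main
  set D : ℝ := (2 * 2 ^ k) ^ ℓ * (2 * a) ^ r * 2 ^ (ℓ + r) with hD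
  have hDpos : 0 < D := by positivity
  have each : ∀ T ∈ P, D⁻¹ ≤ (∏ x ∈ g T, p x) * ∏ x ∈ (g T).biUnion (NN k j) \ g T, (1 - p x) := by
    intro T hT
    obtain ⟨hAT, hj, hk, ht, hx, hl, hr⟩ := hP T hT
    have e1 : ∏ x ∈ g T, p x = (1 / (2 * 2 ^ k)) ^ ℓ * (1 / (2 * a)) ^ r := by
      simp only [hg, prod_disjSum, hp, Sum.elim_inl, Sum.elim_inr, prod_const, hl, hr]
    have e2 := bdry' (NN k j) p h0 h1 (g T) (by
      rintro (x | x) hx'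
      · have hx2 : x ∈ T.1 := by simpa [hg] using hx'
        simp only [NN, prod_map, hp, Function.Embedding.inr_apply, Sum.elim_inr, prod_const]
        refine half_le (by linarith) ?_ ha1
        rw [ha]
        exact_mod_cast deg_up (hj x hx2)
      · have hx2 : x ∈ T.2 := by simpa [hg] using hx'
        simp only [NN, prod_map, hp, Function.Embedding.inl_apply, Sum.elim_inl, prod_const]
        refine half_le (by linarith) ?_ hc1
        rw [card_powersetCard, hk x hx2]
        exact_mod_cast Nat.choose_le_two_pow k j)
    have e3 : (g T).card = ℓ + r := by simp [hg, hl, hr]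
    rw [e3] at e2
    calc D⁻¹ = ((1 / (2 * 2 ^ k)) ^ ℓ * (1 / (2 * a)) ^ r) * (1/2) ^ (ℓ + r) := by
          rw [hD]; simp only [one_div, inv_pow, mul_inv, mul_pow]
      _ ≤ _ := by
          rw [e1]
          exact mul_le_mul_of_nonneg_left e2 (by positivity)
  have := Finset.card_nsmul_le_sum P _ _ each
  rw [nsmul_eq_mul] at this
  have h := this.trans main
  rwa [← div_eq_mul_inv, div_le_one hDpos] at h

def cand (k j : ℕ) (J : Finset (Finset V)) : Finset (Finset V) :=
  (J ×ˢ J ×ˢ (univ : Finset V).powersetCard (k - j - 1)).image (fun t => t.1 ∪ t.2.1 ∪ t.2.2)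

lemma card_cand (k j : ℕ) (J : Finset (Finset V)) :
    (cand k j J).card ≤ J.card * (J.card * Fintype.card V ^ (k - j - 1)) := by
  refine card_image_le.trans ?_
  rw [card_product, card_product, card_powersetCard, card_univ]
  gcongr
  exact Nat.choose_le_pow _ _

lemma mem_cand {k j : ℕ} (hjk : j < k) {J : Finset (Finset V)} {e A B : Finset V} (he : e.card = k)
    (hA : A ∈ J) (hB : B ∈ J) (hAc : A.card = j) (hBc : B.card = j) (hne : A ≠ B)
    (hAe : A ⊆ e) (hBe : B ⊆ e) : e ∈ cand k j J := by
  have hlt : j + 1 ≤ (A ∪ B).card := by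
    by_contra h
    have h' : (A ∪ B).card ≤ j := by omega
    have a := Finset.eq_of_subset_of_card_le (subset_union_left : A ⊆ A ∪ B) (by omega)
    have b := Finset.eq_of_subset_of_card_le (subset_union_right : B ⊆ A ∪ B) (by omega)
    exact hne (a.trans b.symm)
  have hu : A ∪ B ⊆ e := union_subset hAe hBe
  have hc : (e \ (A ∪ B)).card ≤ k - j - 1 := by
    rw [card_sdiff_of_subset hu]; omega
  obtain ⟨T, h1, h2, h3⟩ := Finset.exists_subsuperset_card_eq
    (sdiff_subset : e \ (A ∪ B) ⊆ e) hc (by omega)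
  refine mem_image.2 ⟨(A, B, T), ?_, ?_⟩
  · simp [hA, hB, h3]
  · apply Subset.antisymm
    · exact union_subset hu h2
    · intro x hx
      by_cases hxu : x ∈ A ∪ B
      · exact mem_union_left _ hxu
      · exact mem_union_right _ (h1 (Finset.mem_sdiff.2 ⟨hx, hxu⟩))

lemma blue_count (k j ℓ b : ℕ) (J : Finset (Finset V)) (hJ : J.card = ℓ) :
    (((cand k j J).powersetCard b).card : ℝ) ≤
      4 ^ ℓ * ((ℓ : ℝ) * (Fintype.card V : ℝ) ^ (k - j - 1)) ^ b := by
  rw [card_powersetCard]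
  have h1 : ((cand k j J).card : ℝ) ≤ ℓ * (ℓ * (Fintype.card V : ℝ) ^ (k - j - 1)) := by
    have := card_cand k j J
    rw [hJ] at this
    exact_mod_cast this
  have h2 : (ℓ : ℝ) ^ b / b.factorial ≤ 4 ^ ℓ := by
    refine (Real.pow_div_factorial_le_exp (ℓ : ℝ) (by positivity) b).trans ?_
    rw [← mul_one (ℓ : ℝ), Real.exp_nat_mul]
    gcongr
    linarith [Real.exp_one_lt_d9]
  calc (((cand k j J).card.choose b : ℕ) : ℝ) ≤ ((cand k j J).card : ℝ) ^ b / b.factorial :=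
        Nat.choose_le_pow_div b _
    _ ≤ (ℓ * (ℓ * (Fintype.card V : ℝ) ^ (k - j - 1))) ^ b / b.factorial := by gcongr
    _ = (ℓ : ℝ) ^ b / b.factorial * (ℓ * (Fintype.card V : ℝ) ^ (k - j - 1)) ^ b := by
        rw [mul_pow]; ring
    _ ≤ _ := by gcongr

lemma total (k j : ℕ) (hj : 1 ≤ j) (hjk : j < k) (ℓ r b : ℕ) (hr : r < ℓ) :
    ((minTravTriples k j V ℓ r b).ncard : ℝ) ≤
      (Fintype.card V : ℝ) ^ j * (2 ^ (k + 6)) ^ ℓ * ((Fintype.card V : ℝ) ^ (k - j)) ^ r *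
      ((ℓ : ℝ) * (Fintype.card V : ℝ) ^ (k - j - 1)) ^ b := by
  classical
  rcases Nat.eq_zero_or_pos (Fintype.card V) with hn | hn
  · have : minTravTriples k j V ℓ r b = ∅ := by
      ext T
      simp only [Set.mem_empty_iff_false, iff_false]
      rintro ⟨h1, -, -, -, h2, -⟩
      have : (univ : Finset V).powersetCard j = ∅ := by
        rw [powersetCard_eq_empty, card_univ]; omega
      rw [this, subset_empty] at h1
      rw [h1] at h2
      simp at h2
      omega
    rw [this]
    simp only [Set.ncard_empty, Nat.cast_zero]
    positivity
  set Q : Finset V → Finset (Finset (Finset V) × Finset (Finset V)) := fun A =>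
    univ.filter (fun T => A ∈ T.1 ∧ (∀ B ∈ T.1, B.card = j) ∧ (∀ e ∈ T.2, e.card = k) ∧
      Trav T.1 T.2 ∧ (∀ e ∈ T.2, ∃ B ∈ T.1, B ⊆ e) ∧ T.1.card = ℓ ∧ T.2.card = r) with hQ
  set P := ((univ : Finset V).powersetCard j).biUnion Q with hPdef
  set D : ℝ := (2 * 2 ^ k) ^ ℓ * (2 * (Fintype.card V : ℝ) ^ (k - j)) ^ r * 2 ^ (ℓ + r) with hD
  have hPc : (P.card : ℝ) ≤ (Fintype.card V : ℝ) ^ j * D := by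
    calc (P.card : ℝ) ≤ ((∑ A ∈ (univ : Finset V).powersetCard j, (Q A).card : ℕ) : ℝ) := by
          exact_mod_cast card_biUnion_le
      _ = ∑ A ∈ (univ : Finset V).powersetCard j, ((Q A).card : ℝ) := by push_cast; rfl
      _ ≤ ∑ A ∈ (univ : Finset V).powersetCard j, D := by
          refine sum_le_sum fun A _ => red_root k j ℓ r hn A (Q A) ?_
          intro T hT
          exact (mem_filter.1 hT).2
      _ = ((univ : Finset V).powersetCard j).card * D := by rw [sum_const, nsmul_eq_mul]
      _ ≤ _ := by
          gcongr
          rw [card_powersetCard, card_univ]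
          exact_mod_cast Nat.choose_le_pow _ _
  set B : ℝ := 4 ^ ℓ * ((ℓ : ℝ) * (Fintype.card V : ℝ) ^ (k - j - 1)) ^ b with hB
  set Z : Finset (Finset (Finset V) × Finset (Finset V) × Finset (Finset V)) :=
    P.biUnion (fun T => ((cand k j T.1).powersetCard b).image (fun E => (T.1, T.2, E))) with hZ
  have hsub : minTravTriples k j V ℓ r b ⊆ (Z : Set _) := by
    rintro ⟨J, E1, E2⟩ ⟨hJ, hE1, hE2, ⟨⟨t1, t2⟩, m1, m2⟩, c0, c1, c2⟩
    simp only at hJ hE1 hE2 t1 t2 m1 m2 c0 c1 c2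
    have hJc : ∀ B ∈ J, B.card = j := fun B hB => (mem_powersetCard.1 (hJ hB)).2
    obtain ⟨A, hA⟩ : J.Nonempty := card_pos.1 (by omega)
    simp only [hZ, coe_biUnion, mem_coe, Set.mem_iUnion, mem_image, coe_image, Set.mem_image]
    refine ⟨(J, E1), ?_, E2, ?_, rfl⟩
    · refine mem_biUnion.2 ⟨A, hJ hA, mem_filter.2 ⟨mem_univ _, hA, hJc, ?_, t1, ?_, c0, c1⟩⟩
      · exact fun e he => (mem_powersetCard.1 (hE1 he)).2
      · intro e he
        obtain ⟨A, hA, _, _, _, h, _⟩ := two_of_min t1 (m1 e he)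
        exact ⟨A, hA, h⟩
    · refine mem_powersetCard.2 ⟨fun e he => ?_, c2⟩
      obtain ⟨A, hA, B, hB, hne, h, h'⟩ := two_of_min t2 (m2 e he)
      exact mem_cand hjk (mem_powersetCard.1 (hE2 he)).2 hA hB (hJc A hA) (hJc B hB) hne h h'
  have hB0 : 0 ≤ B := by positivity
  have hZc : (Z.card : ℝ) ≤ P.card * B := by
    calc (Z.card : ℝ) ≤ ((∑ T ∈ P, (((cand k j T.1).powersetCard b).image
            (fun E => (T.1, T.2, E))).card : ℕ) : ℝ) := by exact_mod_cast card_biUnion_le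
      _ = ∑ T ∈ P, ((((cand k j T.1).powersetCard b).image
            (fun E => (T.1, T.2, E))).card : ℝ) := by push_cast; rfl
      _ ≤ ∑ T ∈ P, B := by
          refine sum_le_sum fun T hT => ?_
          obtain ⟨A, _, hA⟩ := mem_biUnion.1 hT
          have hl := (mem_filter.1 hA).2.2.2.2.2.2.1
          refine le_trans ?_ (blue_count k j ℓ b T.1 hl)
          exact_mod_cast card_image_le
      _ = _ := by rw [sum_const, nsmul_eq_mul]
  have hnc : ((minTravTriples k j V ℓ r b).ncard : ℝ) ≤ Z.card := by
    rw [← Set.ncard_coe_finset]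
    exact_mod_cast Set.ncard_le_ncard hsub (Finset.finite_toSet Z)
  have hDle : D * 4 ^ ℓ ≤ (2 ^ (k + 6)) ^ ℓ * ((Fintype.card V : ℝ) ^ (k - j)) ^ r := by
    have e : D * 4 ^ ℓ = ((2 * 2 ^ k) ^ ℓ * 2 ^ ℓ * 4 ^ ℓ) * (4 ^ r) *
        ((Fintype.card V : ℝ) ^ (k - j)) ^ r := by
      rw [hD, mul_pow 2 ((Fintype.card V : ℝ) ^ (k - j)) r, pow_add,
        show (4 : ℝ) ^ r = 2 ^ r * 2 ^ r by rw [← mul_pow]; norm_num]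
      ring
    rw [e]
    gcongr
    calc ((2 * 2 ^ k) ^ ℓ * 2 ^ ℓ * 4 ^ ℓ) * (4 : ℝ) ^ r
        ≤ ((2 * 2 ^ k) ^ ℓ * 2 ^ ℓ * 4 ^ ℓ) * (4 : ℝ) ^ ℓ := by
          gcongr
          norm_num
      _ = (2 ^ (k + 6)) ^ ℓ := by
          rw [← mul_pow, ← mul_pow, ← mul_pow, pow_add]; congr 1; ring
  calc ((minTravTriples k j V ℓ r b).ncard : ℝ) ≤ P.card * B := hnc.trans hZc
    _ ≤ (Fintype.card V : ℝ) ^ j * D * B := by gcongr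
    _ = (Fintype.card V : ℝ) ^ j * (D * 4 ^ ℓ) *
        ((ℓ : ℝ) * (Fintype.card V : ℝ) ^ (k - j - 1)) ^ b := by rw [hB]; ring
    _ ≤ (Fintype.card V : ℝ) ^ j * ((2 ^ (k + 6)) ^ ℓ * ((Fintype.card V : ℝ) ^ (k - j)) ^ r) *
        ((ℓ : ℝ) * (Fintype.card V : ℝ) ^ (k - j - 1)) ^ b := by gcongr
    _ = _ := by ring

lemma total_one (k j : ℕ) :
    ((minTravTriples k j V 1 0 0).ncard : ℝ) ≤ (Fintype.card V : ℝ) ^ j := by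
  have hsub : minTravTriples k j V 1 0 0 ⊆
      ((((univ : Finset V).powersetCard j).image (fun A => (({A} : Finset (Finset V)),
        (∅ : Finset (Finset V)), (∅ : Finset (Finset V)))) :
        Finset (Finset (Finset V) × Finset (Finset V) × Finset (Finset V))) : Set _) := by
    rintro ⟨J, E1, E2⟩ ⟨hJ, -, -, -, c0, c1, c2⟩
    simp only at hJ c0 c1 c2
    obtain ⟨A, rfl⟩ := card_eq_one.1 c0
    rw [card_eq_zero] at c1 c2
    subst c1 c2
    exact mem_coe.2 (mem_image.2 ⟨A, hJ (mem_singleton_self A), rfl⟩)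
  have h := Set.ncard_le_ncard hsub (Finset.finite_toSet _)
  rw [Set.ncard_coe_finset] at h
  have h2 := h.trans card_image_le
  rw [card_powersetCard, card_univ] at h2
  exact_mod_cast h2.trans (Nat.choose_le_pow _ _)

end count
end TravAux

/-- **Lemma.** Let `1 ≤ j ≤ k−1`.  There is a constant `C = C(k,j) > 0` such that for every
finite set `V` and all integers `ℓ > r ≥ 0`, `ℓ > b ≥ 0`, the number of edge-minimal
traversable triples on `V` of size `ℓ` with `r` red and `b` blue edges satisfies
`|T_{ℓ,r,b}| ≤ |V|^j · C^{ℓ−1} · (|V|^{k−j})^r · (ℓ·|V|^{k−j−1})^b`. -/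
theorem minTravTriples_card_upper_bound (k j : ℕ) (hj : 1 ≤ j) (hjk : j ≤ k - 1) :
    ∃ C : ℝ, 0 < C ∧
      ∀ (V : Type) [DecidableEq V] [Fintype V], ∀ ℓ r b : ℕ, r < ℓ → b < ℓ →
        ((minTravTriples k j V ℓ r b).ncard : ℝ) ≤
          (Fintype.card V : ℝ) ^ j * C ^ (ℓ - 1) *
            ((Fintype.card V : ℝ) ^ (k - j)) ^ r *
            ((ℓ : ℝ) * (Fintype.card V : ℝ) ^ (k - j - 1)) ^ b := by
  refine ⟨(2 ^ (k + 6)) ^ 2, by positivity, ?_⟩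
  intro V _ _ ℓ r b hr hb
  have hjk' : j < k := by omega
  rcases Nat.lt_or_ge ℓ 2 with hl | hl
  · obtain rfl : ℓ = 1 := by omega
    obtain rfl : r = 0 := by omega
    obtain rfl : b = 0 := by omega
    simpa using TravAux.total_one (V := V) k j
  · refine (TravAux.total k j hj hjk' ℓ r b hr).trans ?_
    have : ((2 : ℝ) ^ (k + 6)) ^ ℓ ≤ ((2 ^ (k + 6)) ^ 2) ^ (ℓ - 1) := by
      rw [← pow_mul ((2 : ℝ) ^ (k + 6)) 2 (ℓ - 1)]
      exact pow_le_pow_right₀ (one_le_pow₀ (by norm_num)) (by omega)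
    gcongr
end
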